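/- Let c ∈ (0, 2^{-7/3}) be a constant, let p = p(n) < c·n^{-1/3}, and let G ~ G_{n,p}. Suppose 3 ≤ ℓ = ℓ(n) ≤ v = v(n) and w = w(n) are sequences of non-negative integers with w ≤ 2v². Then for every δ > 0 there exists n_0 such that for all n ≥ n_0, E[Z^ℓ_{v,w}] ≤ n^{(−1/3+δ)w + (1/3+δ)ℓ + 1} · v^{6w} · (2^7 c^3)^v. -/

import Mathlib

namespace WSat

variable {V : Type} [Fintype V] [DecidableEq V]

/-- The edges of the triangle recorded in an activation step `(a, b, c)`:
the step activates the edge `{a, b}` using the triangle `{a, b, c}`. -/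
def triEdges (st : V × V × V) : Set (Sym2 V) :=
  {s(st.1, st.2.1), s(st.1, st.2.2), s(st.2.1, st.2.2)}

/-- The graph `H ∪ Δ₁ ∪ ⋯ ∪ Δ_s`. -/
def afterGraph (H : SimpleGraph V) (steps : List (V × V × V)) : SimpleGraph V :=
  H ⊔ SimpleGraph.fromEdgeSet {e | ∃ st ∈ steps, e ∈ triEdges st}

/-- `(H; Δ₁, …, Δ_s)` is a (`K₃`-bootstrap) activation process: at each step `i`, the
step `(a, b, c)` adds the new edge `{a, b}` (not present before), which forms the triangle
`{a, b, c}` together with the two previously present edges `{a, c}` and `{b, c}`. -/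
def IsValidProcess (H : SimpleGraph V) (steps : List (V × V × V)) : Prop :=
  ∀ (i : ℕ) (hi : i < steps.length),
    (steps.get ⟨i, hi⟩).1 ≠ (steps.get ⟨i, hi⟩).2.1 ∧
    ¬ (afterGraph H (steps.take i)).Adj (steps.get ⟨i, hi⟩).1 (steps.get ⟨i, hi⟩).2.1 ∧
    (afterGraph H (steps.take i)).Adj (steps.get ⟨i, hi⟩).1 (steps.get ⟨i, hi⟩).2.2 ∧
    (afterGraph H (steps.take i)).Adj (steps.get ⟨i, hi⟩).2.1 (steps.get ⟨i, hi⟩).2.2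

/-- The number of (non-isolated) vertices of `G`. -/
noncomputable def supportCard (G : SimpleGraph V) : ℕ := Nat.card G.support

/-- The number of edges of `G`. -/
noncomputable def edgeCard (G : SimpleGraph V) : ℕ := Nat.card G.edgeSet

/-- `con_A(e)`: the number of triangles of the process containing `e` that do not
activate `e`. -/
noncomputable def conA (steps : List (V × V × V)) (e : Sym2 V) : ℕ :=
  Nat.card {i : Fin steps.length //
    e = s((steps.get i).1, (steps.get i).2.2) ∨ e = s((steps.get i).2.1, (steps.get i).2.2)}

open scoped Classical in
/-- `exc_A(e)` relative to the initial graph `H` and the target graph `C`. -/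
noncomputable def excA (H C : SimpleGraph V) (steps : List (V × V × V)) (e : Sym2 V) : ℤ :=
  (conA steps e : ℤ) -
    (if e ∈ C.edgeSet then (if e ∈ H.edgeSet then 1 else 0)
     else (if e ∈ H.edgeSet then 2 else 1))

/-- `exc(A) = Σ_e exc_A(e)`, summed over the edges of `K(A)`. -/
noncomputable def excSum (H C : SimpleGraph V) (steps : List (V × V × V)) : ℤ :=
  ∑ᶠ e ∈ (afterGraph H steps).edgeSet, excA H C steps e

/-- A nice activation process from `H` activating `C` (that is, every edge of the
activation complex has nonnegative excess). -/
def NiceProcess (H C : SimpleGraph V) (steps : List (V × V × V)) : Prop :=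
  IsValidProcess H steps ∧ C ≤ afterGraph H steps ∧
    ∀ e ∈ (afterGraph H steps).edgeSet, 0 ≤ excA H C steps e

/-- A nice activation process from `H` activating `C` inside the ambient graph `G`. -/
def NiceActivation (G H C : SimpleGraph V) (steps : List (V × V × V)) : Prop :=
  NiceProcess H C steps ∧ afterGraph H steps ≤ G

/-- The subgraph consisting of the edges of the walk `w`. -/
def walkEdgeGraph {G : SimpleGraph V} {x y : V} (w : G.Walk x y) : SimpleGraph V :=
  SimpleGraph.fromEdgeSet {e | e ∈ w.edges}

/-- The complexity `d_H = |E(H)| − |V(H)| + 1` of a graph `H`. -/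
noncomputable def complexity (H : SimpleGraph V) : ℤ :=
  (edgeCard H : ℤ) - (supportCard H : ℤ) + 1

/-- The state of a (partially built) activation diagram: vertex identifiers
`0, …, nv - 1`, their labels, the internal boundary (a cyclic list of vertex identifiers),
the set of marked boundary edges, and the list of triangular faces glued so far. -/
structure DiagState (V : Type) where
  nv : ℕ
  label : ℕ → V
  boundary : List ℕ
  marked : Set (Sym2 ℕ)
  faces : List (ℕ × ℕ × ℕ)

/-- The edges of the cyclic list `B`. -/
def cycEdges (B : List ℕ) : Set (Sym2 ℕ) :=
  {e | e ∈ (B.zip (B.rotate 1)).map fun q => s(q.1, q.2)}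

/-- The initial state `D_{s+1} = C` for a cycle whose cyclic list of vertex labels is
`cyc` (with default label `x`): the boundary is the cycle, all of its edges are marked,
and there are no faces. -/
def initState (x : V) (cyc : List V) : DiagState V where
  nv := cyc.length
  label := fun i => cyc.getD i x
  boundary := List.range cyc.length
  marked := cycEdges (List.range cyc.length)
  faces := []

/-- The marked edges after gluing a triangle with apex labelled `c` onto the boundary edge
`{u, v}`: the edge `{u, v}` is unmarked, and each of the two new edges is marked unless a
marked edge with the same pair of labels already exists. -/
def glueMarked (D : DiagState V) (u v : ℕ) (c : V) : Set (Sym2 ℕ) :=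
  (D.marked \ {s(u, v)}) ∪
    {f | (f = s(u, D.nv) ∧ ¬ ∃ e ∈ D.marked, Sym2.map D.label e = s(D.label u, c)) ∨
         (f = s(v, D.nv) ∧ ¬ ∃ e ∈ D.marked, Sym2.map D.label e = s(D.label v, c))}

/-- The state obtained from `D` by gluing a triangle with apex labelled `c` onto the
boundary edge at position `i`. -/
def glueResult (D : DiagState V) (i : ℕ) (c : V) : DiagState V where
  nv := D.nv + 1
  label := Function.update D.label D.nv c
  boundary := D.boundary.take (i + 1) ++ D.nv :: D.boundary.drop (i + 1)
  marked := glueMarked D (D.boundary.getD i 0)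
    (D.boundary.getD ((i + 1) % D.boundary.length) 0) c
  faces := (D.boundary.getD i 0,
    D.boundary.getD ((i + 1) % D.boundary.length) 0, D.nv) :: D.faces

/-- Gluing a triangle labelled `{a, b, c}` (activating the edge labelled `{a, b}`, apex
labelled `c`) onto a marked internal boundary edge whose labels are `{a, b}`. -/
def GlueStep (D D' : DiagState V) (a b c : V) : Prop :=
  ∃ i : ℕ, i < D.boundary.length ∧
    s(D.boundary.getD i 0, D.boundary.getD ((i + 1) % D.boundary.length) 0) ∈ D.marked ∧
    s(D.label (D.boundary.getD i 0),
      D.label (D.boundary.getD ((i + 1) % D.boundary.length) 0)) = s(a, b) ∧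
    D' = glueResult D i c

/-- `DiagReaches steps D D'` holds when `D'` is obtained from `D` by gluing the triangles
of `steps` in reverse order (`Δ_s` first, `Δ₁` last), as in the activation diagram
construction. -/
def DiagReaches : List (V × V × V) → DiagState V → DiagState V → Prop
  | [], D, D' => D' = D
  | st :: rest, D, D' => ∃ Dmid, DiagReaches rest D Dmid ∧ GlueStep Dmid D' st.1 st.2.1 st.2.2

/-- The set of faces of a diagram state, as 3-element sets of vertex identifiers. -/
def faceSets (D : DiagState V) : Set (Finset ℕ) :=
  {t | ∃ q ∈ D.faces, t = ({q.1, q.2.1, q.2.2} : Finset ℕ)}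

/-- Isomorphism of labelled diagrams. -/
def DiagIso (D₁ D₂ : DiagState V) : Prop :=
  ∃ f : ℕ → ℕ,
    D₂.nv = D₁.nv ∧
    Set.InjOn f {i | i < D₁.nv} ∧
    (∀ i < D₁.nv, f i < D₁.nv) ∧
    (∀ i < D₁.nv, D₂.label (f i) = D₁.label i) ∧
    (D₁.boundary.map f).IsRotated D₂.boundary ∧
    D₂.marked = Sym2.map f '' D₁.marked ∧
    faceSets D₂ = (fun t => t.image f) '' faceSets D₁

/-- `P_{v,w}(ℓ,n)`: the collection of `A`-activation diagrams for nice activation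
processes `A = (H; Δ₁, …, Δ_s)` of an `ℓ`-cycle with `V(H) ⊆ [n]`, `|V(H)| = v` and
`2·d_H + exc(A) = w`. -/
def Pvw (n ℓ v w : ℕ) : Set (DiagState (Fin n)) :=
  {D | ∃ (H : SimpleGraph (Fin n)) (steps : List (Fin n × Fin n × Fin n)) (x : Fin n)
        (wk : (afterGraph H steps).Walk x x),
      wk.IsCycle ∧ wk.length = ℓ ∧
      NiceProcess H (walkEdgeGraph wk) steps ∧
      supportCard H = v ∧
      2 * complexity H + excSum H (walkEdgeGraph wk) steps = (w : ℤ) ∧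
      DiagReaches steps (initState x wk.support.dropLast) D}

/-- `|P_{v,w}(ℓ,n)|`: the number of such diagrams, counted up to isomorphism. -/
noncomputable def PvwCard (n ℓ v w : ℕ) : ℕ :=
  Nat.card
    (Quot fun (D₁ D₂ : {D : DiagState (Fin n) // D ∈ Pvw n ℓ v w}) => DiagIso D₁.1 D₂.1)

/-- All faces of the diagram `D` are (labelled) triangles of the graph `G`, i.e. the
diagram lies in the clique complex `X⁽²⁾(G)`. -/
def FacesInGraph {n : ℕ} (D : DiagState (Fin n)) (G : SimpleGraph (Fin n)) : Prop :=
  ∀ q ∈ D.faces, G.Adj (D.label q.1) (D.label q.2.1) ∧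
    G.Adj (D.label q.1) (D.label q.2.2) ∧ G.Adj (D.label q.2.1) (D.label q.2.2)

/-- `Z^ℓ_{v,w}(G)`: the number of diagrams `D ∈ P_{v,w}` (counted up to isomorphism) all
of whose triangles belong to `X⁽²⁾(G)`. -/
noncomputable def Zval (n ℓ v w : ℕ) (G : SimpleGraph (Fin n)) : ℕ :=
  Nat.card (Quot fun (D₁ D₂ : {D : DiagState (Fin n) //
      D ∈ Pvw n ℓ v w ∧ FacesInGraph D G}) => DiagIso D₁.1 D₂.1)

open scoped Classical in
/-- The expectation `E[Z^ℓ_{v,w}]` for `G ∼ G_{n,p}`. -/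
noncomputable def expZ (n ℓ v w : ℕ) (p : ℝ) : ℝ :=
  ∑ G : SimpleGraph (Fin n),
    (p ^ edgeCard G * (1 - p) ^ (n.choose 2 - edgeCard G)) * (Zval n ℓ v w G : ℝ)

/-! ### Exploration of a walk -/
section Walks
set_option linter.unusedSectionVars false
variable {W : Type} [DecidableEq W]

/-- Exploration state of a walk: current vertex, visited vertices, open tree edges. -/
structure XSt (W : Type) where
  cur : W
  seen : Finset W
  opn : Finset (Sym2 W)

def XSt.step (σ : XSt W) (y : W) : XSt W :=
  if y ∈ σ.seen then
    (if s(σ.cur, y) ∈ σ.opn then ⟨y, σ.seen, σ.opn.erase s(σ.cur, y)⟩ else ⟨y, σ.seen, σ.opn⟩)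
  else ⟨y, insert y σ.seen, insert s(σ.cur, y) σ.opn⟩

def XSt.run (σ : XSt W) : List W → XSt W
  | [] => σ
  | y :: l => (σ.step y).run l

def XSt.isX (σ : XSt W) (y : W) : ℕ := if y ∈ σ.seen ∧ s(σ.cur, y) ∉ σ.opn then 1 else 0

def XSt.xc (σ : XSt W) : List W → ℕ
  | [] => 0
  | y :: l => σ.isX y + (σ.step y).xc l

structure XSt.Inv (σ : XSt W) : Prop where
  cur_mem : σ.cur ∈ σ.seen
  mem : ∀ e ∈ σ.opn, ∀ u ∈ e, u ∈ σ.seen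
  nd : ∀ e ∈ σ.opn, ¬ e.IsDiag

lemma XSt.Inv.step {σ : XSt W} (h : σ.Inv) (y : W) : (σ.step y).Inv := by
  unfold XSt.step
  split_ifs with h1 h2
  · exact ⟨h1, fun e he => h.mem e (Finset.mem_of_mem_erase he),
      fun e he => h.nd e (Finset.mem_of_mem_erase he)⟩
  · exact ⟨h1, h.mem, h.nd⟩
  · refine ⟨Finset.mem_insert_self _ _, ?_, ?_⟩
    · intro e he u hu
      rcases Finset.mem_insert.1 he with rfl | he
      · rcases Sym2.mem_iff.1 hu with rfl | rfl
        · exact Finset.mem_insert_of_mem h.cur_mem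
        · exact Finset.mem_insert_self _ _
      · exact Finset.mem_insert_of_mem (h.mem e he u hu)
    · intro e he
      rcases Finset.mem_insert.1 he with rfl | he
      · intro hd
        rw [Sym2.mk_isDiag_iff] at hd
        exact h1 (hd ▸ h.cur_mem)
      · exact h.nd e he

lemma XSt.seen_step_le (σ : XSt W) (y : W) : σ.seen ⊆ (σ.step y).seen := by
  unfold XSt.step
  split_ifs
  · exact subset_rfl
  · exact subset_rfl
  · exact Finset.subset_insert _ _

lemma XSt.seen_run_le (σ : XSt W) (l : List W) : σ.seen ⊆ (σ.run l).seen := by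
  induction l generalizing σ with
  | nil => exact subset_rfl
  | cons y l ih => exact (σ.seen_step_le y).trans (ih _)

lemma XSt.seen_run (σ : XSt W) (l : List W) : (σ.run l).seen = σ.seen ∪ l.toFinset := by
  induction l generalizing σ with
  | nil => simp [XSt.run]
  | cons y l ih =>
    simp only [XSt.run]
    rw [ih]
    unfold XSt.step
    ext z
    split_ifs <;> simp <;> grind

def XSt.deg (σ : XSt W) (u : W) : ℕ := (σ.opn.filter (fun e => u ∈ e)).card

def XSt.pt (σ : XSt W) (u : W) : ℕ := if u = σ.cur then σ.deg u - 1 else σ.deg u - 2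

lemma XSt.counts {σ : XSt W} (h : σ.Inv) (l : List W) :
    σ.xc l + 2 * (σ.run l).seen.card + σ.opn.card
      = l.length + (σ.run l).opn.card + 2 * σ.seen.card := by
  induction l generalizing σ with
  | nil => simp [XSt.run, XSt.xc]; omega
  | cons y l ih =>
    have := ih (h.step y)
    simp only [XSt.run, XSt.xc, List.length_cons]
    have key : σ.isX y + 2 * (σ.step y).seen.card + σ.opn.card
        = 1 + (σ.step y).opn.card + 2 * σ.seen.card := by
      by_cases h1 : y ∈ σ.seen
      · by_cases h4 : s(σ.cur, y) ∈ σ.opn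
        · have := Finset.card_erase_add_one h4
          simp [XSt.isX, XSt.step, h1, h4] at this ⊢; omega
        · simp [XSt.isX, XSt.step, h1, h4]; omega
      · have h5 : s(σ.cur, y) ∉ σ.opn := fun hh => h1 (h.mem _ hh y (by simp))
        simp [XSt.isX, XSt.step, h1, Finset.card_insert_of_notMem h5]; omega
    omega

/-- The edges of a walk. -/
def edgesFrom : W → List W → List (Sym2 W)
  | _, [] => []
  | x, y :: l => s(x, y) :: edgesFrom y l

lemma XSt.cur_step (σ : XSt W) (y : W) : (σ.step y).cur = y := by
  unfold XSt.step; split_ifs <;> rfl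

lemma XSt.opn_count {σ : XSt W} (h : σ.Inv) (hist : List (Sym2 W)) (l : List W)
    (h1 : ∀ e ∈ σ.opn, hist.count e = 1) (h2 : ∀ e ∈ hist, ∀ u ∈ e, u ∈ σ.seen) :
    ∀ e ∈ (σ.run l).opn, (hist ++ edgesFrom σ.cur l).count e = 1 := by
  induction l generalizing σ hist with
  | nil => simpa [XSt.run, edgesFrom] using h1
  | cons y l ih =>
    have := ih (h.step y) (hist ++ [s(σ.cur, y)]) ?_ ?_
    · simpa [XSt.run, edgesFrom, XSt.cur_step] using this
    · intro e he
      rw [List.count_append, List.count_singleton]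
      unfold XSt.step at he
      split_ifs at he with h3 h4
      · simp only [Finset.mem_erase] at he
        rw [h1 e he.2]; simp [Ne.symm he.1]
      · have : e ≠ s(σ.cur, y) := fun hh => h4 (hh ▸ he)
        simp only at he
        rw [h1 e he]; simp [Ne.symm this]
      · simp only [Finset.mem_insert] at he
        have h5 : s(σ.cur, y) ∉ hist := fun hh => h3 (h2 _ hh y (by simp))
        by_cases hee : e = s(σ.cur, y)
        · subst hee
          rw [List.count_eq_zero_of_not_mem h5]; simp
        · rw [h1 e (he.resolve_left hee)]; simp [Ne.symm hee]
    · intro e he u hu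
      rcases List.mem_append.1 he with he | he
      · exact σ.seen_step_le y (h2 e he u hu)
      · simp only [List.mem_singleton] at he
        subst he
        rcases Sym2.mem_iff.1 hu with rfl | rfl
        · exact σ.seen_step_le y h.cur_mem
        · have := (h.step u).cur_mem
          rwa [XSt.cur_step] at this

variable [Fintype W]

def XSt.Ψ (σ : XSt W) : ℕ := ∑ u, σ.pt u

lemma XSt.Ψ_D {σ : XSt W} (h : σ.Inv) {y : W} (hy : y ∉ σ.seen) : (σ.step y).Ψ ≤ σ.Ψ := by
  unfold XSt.Ψ
  apply Finset.sum_le_sum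
  intro u _
  have h5 : s(σ.cur, y) ∉ σ.opn := fun hh => hy (h.mem _ hh y (by simp))
  have hcy : σ.cur ≠ y := fun hh => hy (hh ▸ h.cur_mem)
  unfold XSt.pt XSt.deg XSt.step
  rw [if_neg hy]
  simp only [Finset.filter_insert]
  by_cases huy : u = y
  · subst huy
    have h0 : σ.opn.filter (fun e => u ∈ e) = ∅ := by
      rw [Finset.filter_eq_empty_iff]
      intro e he hu
      exact hy (h.mem e he u hu)
    simp [h0]
  · by_cases huc : u = σ.cur
    · subst huc
      simp only [Sym2.mem_iff, true_or, if_true, if_neg hcy]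
      have := Finset.card_insert_le s(σ.cur, y) (σ.opn.filter (fun e => σ.cur ∈ e))
      omega
    · simp [huy, huc]

lemma XSt.Ψ_X {σ : XSt W} {y : W} (hy : y ∈ σ.seen) (hx : s(σ.cur, y) ∉ σ.opn) :
    (σ.step y).Ψ ≤ σ.Ψ + 1 := by
  unfold XSt.Ψ
  have : (∑ u, σ.pt u) + 1 = ∑ u, (σ.pt u + if u = y then 1 else 0) := by
    rw [Finset.sum_add_distrib]; simp
  rw [this]
  apply Finset.sum_le_sum
  intro u _
  unfold XSt.pt XSt.deg XSt.step
  rw [if_pos hy, if_neg hx]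
  simp only
  split_ifs <;> omega

lemma XSt.deg_R {σ : XSt W} {y : W} (hx : s(σ.cur, y) ∈ σ.opn) (u : W) :
    ((σ.opn.erase s(σ.cur, y)).filter (fun e => u ∈ e)).card
      + (if u ∈ s(σ.cur, y) then 1 else 0) = σ.deg u := by
  unfold XSt.deg
  rw [Finset.filter_erase]
  split_ifs with h
  · exact Finset.card_erase_add_one (by simp [hx] at h ⊢; tauto)
  · rw [Finset.erase_eq_of_notMem (by simp at h ⊢; tauto)]; rfl

lemma XSt.pt_R {σ : XSt W} (h : σ.Inv) {y : W} (hx : s(σ.cur, y) ∈ σ.opn) (u : W) :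
    (σ.step y).pt u + (if u = σ.cur ∧ 2 ≤ σ.deg σ.cur then 1 else 0) ≤ σ.pt u := by
  have hy : y ∈ σ.seen := h.mem _ hx y (by simp)
  have hcy : σ.cur ≠ y := fun hh => h.nd _ hx (by simpa using hh)
  have hd := XSt.deg_R hx u
  have e1 : (σ.step y).deg u + (if u ∈ s(σ.cur, y) then 1 else 0) = σ.deg u := by
    rw [← hd]; unfold XSt.deg XSt.step; rw [if_pos hy, if_pos hx]
  unfold XSt.pt
  rw [XSt.cur_step]
  simp only [Sym2.mem_iff] at e1
  by_cases huy : u = y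
  · subst huy
    simp [hcy.symm] at e1 ⊢; omega
  · by_cases huc : u = σ.cur
    · subst huc
      simp [hcy] at e1 ⊢
      split_ifs <;> omega
    · simp [huy, huc] at e1 ⊢; omega

lemma XSt.Ψ_R {σ : XSt W} (h : σ.Inv) {y : W} (hx : s(σ.cur, y) ∈ σ.opn) :
    (σ.step y).Ψ + (if 2 ≤ σ.deg σ.cur then 1 else 0) ≤ σ.Ψ := by
  unfold XSt.Ψ
  have := Finset.sum_le_sum (fun u (_ : u ∈ Finset.univ) => XSt.pt_R h hx u)
  rw [Finset.sum_add_distrib] at this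
  refine le_trans (le_of_eq ?_) this
  congr 1
  by_cases h2 : 2 ≤ σ.deg σ.cur <;> simp [h2]

/-- All lists of a given length. -/
def listsOf (W : Type) [Fintype W] [DecidableEq W] : ℕ → Finset (List W)
  | 0 => {[]}
  | k + 1 => (Finset.univ ×ˢ listsOf W k).image (fun q => q.1 :: q.2)

lemma mem_listsOf (k : ℕ) (l : List W) : l ∈ listsOf W k ↔ l.length = k := by
  induction k generalizing l with
  | zero => simp [listsOf]
  | succ k ih =>
    cases l with
    | nil => simp [listsOf]
    | cons y l => simp [listsOf, ih]

lemma sum_listsOf_succ (k : ℕ) (g : List W → ℝ) :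
    ∑ l ∈ listsOf W (k + 1), g l = ∑ y, ∑ l ∈ listsOf W k, g (y :: l) := by
  rw [listsOf, Finset.sum_image, Finset.sum_product]
  rintro ⟨a, b⟩ _ ⟨c, d⟩ _ hh
  simpa using hh

noncomputable def walkW (v : ℕ) (σ : XSt W) (l : List W) : ℝ :=
  if (σ.run l).seen.card = v then ((v : ℝ) ^ (3 * σ.xc l))⁻¹ else 0

lemma walkW_nonneg (v : ℕ) (σ : XSt W) (l : List W) : 0 ≤ walkW v σ l := by
  unfold walkW; split_ifs <;> positivity

lemma walkW_cons (v : ℕ) (σ : XSt W) (y : W) (l : List W) :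
    walkW v σ (y :: l) = ((v : ℝ) ^ (3 * σ.isX y))⁻¹ * walkW v (σ.step y) l := by
  have h1 : σ.run (y :: l) = (σ.step y).run l := rfl
  have h2 : σ.xc (y :: l) = σ.isX y + (σ.step y).xc l := rfl
  unfold walkW
  rw [h1, h2]
  by_cases h : ((σ.step y).run l).seen.card = v
  · rw [if_pos h, if_pos h, mul_add, pow_add, mul_inv]
  · rw [if_neg h, if_neg h, mul_zero]

lemma card_R (σ : XSt W) :
    (Finset.univ.filter (fun y => s(σ.cur, y) ∈ σ.opn)).card ≤ σ.deg σ.cur := by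
  unfold XSt.deg
  apply Finset.card_le_card_of_injOn (fun y => s(σ.cur, y))
  · intro y hy
    simpa using hy
  · intro a _ b _ hab
    have : a = b ∨ σ.cur = b ∧ a = σ.cur := by simpa using hab
    rcases this with h | ⟨h1, h2⟩
    · exact h
    · rw [h2, h1]

lemma walk_sum (v : ℕ) (hv : 1 ≤ v) (k : ℕ) (σ : XSt W) (h : σ.Inv) (hle : σ.seen.card ≤ v) :
    (Fintype.card W : ℝ) ^ σ.seen.card * ∑ l ∈ listsOf W k, walkW v σ l
      ≤ (Fintype.card W : ℝ) ^ v * (v : ℝ) ^ σ.Ψ * (2 + 1 / (v : ℝ)) ^ k := by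
  have hv1 : (1 : ℝ) ≤ v := by exact_mod_cast hv
  have hv0 : (0 : ℝ) < v := by linarith
  have hn1 : (1 : ℝ) ≤ Fintype.card W := by
    exact_mod_cast Fintype.card_pos_iff.2 ⟨σ.cur⟩
  induction k generalizing σ with
  | zero =>
    simp only [listsOf, Finset.sum_singleton, pow_zero, mul_one]
    have h1 : σ.run [] = σ := rfl
    have h2 : σ.xc [] = 0 := rfl
    unfold walkW
    rw [h1, h2]
    by_cases hh : σ.seen.card = v
    · rw [if_pos hh, hh]; simp
      exact le_mul_of_one_le_right (by positivity) (one_le_pow₀ hv1)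
    · rw [if_neg hh, mul_zero]; positivity
  | succ k ih =>
    rw [sum_listsOf_succ, Finset.mul_sum]
    set N : ℝ := (Fintype.card W : ℝ) with hN
    set q : ℝ := 2 + 1 / (v : ℝ) with hq
    have hq0 : 0 < q := by positivity
    set A : ℝ := N ^ v * (v : ℝ) ^ σ.Ψ * q ^ k with hA
    have hA0 : 0 < A := by positivity
    set T : W → ℝ := fun y => N ^ σ.seen.card * ∑ l ∈ listsOf W k, walkW v σ (y :: l) with hT
    have hTeq : ∀ y, T y = N ^ σ.seen.card * (((v : ℝ) ^ (3 * σ.isX y))⁻¹ *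
        ∑ l ∈ listsOf W k, walkW v (σ.step y) l) := by
      intro y
      simp only [hT, walkW_cons, Finset.mul_sum]
    -- D steps
    have hD : ∀ y, y ∉ σ.seen → T y ≤ A / N := by
      intro y hy
      have hX : σ.isX y = 0 := by simp [XSt.isX, hy]
      have hs : (σ.step y).seen.card = σ.seen.card + 1 := by
        unfold XSt.step; rw [if_neg hy]; simp [Finset.card_insert_of_notMem hy]
      rw [hTeq, hX]
      simp only [mul_zero, pow_zero, inv_one, one_mul]
      rcases Nat.lt_or_ge σ.seen.card v with hlt | hge
      · have h1 := ih (σ.step y) (h.step y) (by omega)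
        rw [hs, pow_succ] at h1
        rw [le_div_iff₀ (by linarith)]
        calc _ = N ^ σ.seen.card * N * ∑ l ∈ listsOf W k, walkW v (σ.step y) l := by ring
          _ ≤ _ := h1
          _ ≤ A := by
            rw [hA]
            gcongr
            exact XSt.Ψ_D h hy
      · have : ∑ l ∈ listsOf W k, walkW v (σ.step y) l = 0 := by
          apply Finset.sum_eq_zero
          intro l _
          unfold walkW
          rw [if_neg]
          have := Finset.card_le_card ((σ.step y).seen_run_le l)
          omega
        rw [this, mul_zero]; positivity
    have hRX : ∀ y, y ∈ σ.seen → N ^ σ.seen.card * ∑ l ∈ listsOf W k, walkW v (σ.step y) l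
        ≤ N ^ v * (v : ℝ) ^ (σ.step y).Ψ * q ^ k := by
      intro y hy
      have hs : (σ.step y).seen = σ.seen := by
        unfold XSt.step; rw [if_pos hy]; split_ifs <;> rfl
      have h1 := ih (σ.step y) (h.step y) (by rw [hs]; exact hle)
      rwa [hs] at h1
    have hR : ∀ y, s(σ.cur, y) ∈ σ.opn → T y ≤ if 2 ≤ σ.deg σ.cur then A / v else A := by
      intro y hy
      have hys : y ∈ σ.seen := h.mem _ hy y (by simp)
      have hX : σ.isX y = 0 := by simp [XSt.isX, hy]
      rw [hTeq, hX]
      simp only [mul_zero, pow_zero, inv_one, one_mul]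
      refine (hRX y hys).trans ?_
      have hΨ := XSt.Ψ_R h hy
      split_ifs at hΨ ⊢ with h2
      · rw [le_div_iff₀ hv0]
        calc _ = N ^ v * (v : ℝ) ^ ((σ.step y).Ψ + 1) * q ^ k := by rw [pow_succ]; ring
          _ ≤ A := by rw [hA]; gcongr
      · rw [hA]; gcongr
        omega
    have hXX : ∀ y, y ∈ σ.seen → s(σ.cur, y) ∉ σ.opn → T y ≤ A / v ^ 2 := by
      intro y hy hx
      have hX : σ.isX y = 1 := by simp [XSt.isX, hy, hx]
      rw [hTeq, hX, mul_left_comm]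
      have := XSt.Ψ_X hy hx
      calc _ ≤ ((v : ℝ) ^ (3 * 1))⁻¹ * (N ^ v * (v : ℝ) ^ (σ.step y).Ψ * q ^ k) := by
            exact mul_le_mul_of_nonneg_left (hRX y hy) (by positivity)
        _ ≤ ((v : ℝ) ^ (3 * 1))⁻¹ * (N ^ v * (v : ℝ) ^ (σ.Ψ + 1) * q ^ k) := by
            gcongr
        _ = A / v ^ 2 := by
            rw [hA]; field_simp; ring
    have hsplit : ∑ y, T y = ∑ y ∈ Finset.univ.filter (fun y => y ∉ σ.seen), T y
        + (∑ y ∈ Finset.univ.filter (fun y => s(σ.cur, y) ∈ σ.opn), T y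
        + ∑ y ∈ Finset.univ.filter (fun y => y ∈ σ.seen ∧ s(σ.cur, y) ∉ σ.opn), T y) := by
      rw [Finset.sum_filter, Finset.sum_filter, Finset.sum_filter, ← Finset.sum_add_distrib,
        ← Finset.sum_add_distrib]
      apply Finset.sum_congr rfl
      intro y _
      by_cases h1 : y ∈ σ.seen
      · by_cases h2 : s(σ.cur, y) ∈ σ.opn <;> simp [h1, h2]
      · have : s(σ.cur, y) ∉ σ.opn := fun hh => h1 (h.mem _ hh y (by simp))
        simp [h1, this]
    have b1 : ∑ y ∈ Finset.univ.filter (fun y => y ∉ σ.seen), T y ≤ A := by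
      calc _ ≤ ∑ y ∈ Finset.univ.filter (fun y => y ∉ σ.seen), A / N :=
            Finset.sum_le_sum (fun y hy => hD y (by simpa using hy))
        _ ≤ ∑ y : W, A / N := by
            apply Finset.sum_le_sum_of_subset_of_nonneg (Finset.filter_subset _ _)
            intros; positivity
        _ = A := by
            rw [Finset.sum_const, nsmul_eq_mul, Finset.card_univ, ← hN]; field_simp
    have b2 : ∑ y ∈ Finset.univ.filter (fun y => s(σ.cur, y) ∈ σ.opn), T y ≤ A := by
      have hc := card_R σ
      have hc2 : (Finset.univ.filter (fun y => s(σ.cur, y) ∈ σ.opn)).card ≤ v := by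
        refine (Finset.card_le_card ?_).trans hle
        intro y hy
        exact h.mem _ (Finset.mem_filter.1 hy).2 y (by simp)
      refine (Finset.sum_le_sum (fun y hy => hR y (by simpa using hy))).trans ?_
      rw [Finset.sum_const, nsmul_eq_mul]
      split_ifs with h2
      · calc _ ≤ (v : ℝ) * (A / v) := by gcongr
          _ = A := by field_simp
      · calc _ ≤ (1 : ℝ) * A := by
              gcongr; exact_mod_cast (by omega : _ ≤ 1)
          _ = A := one_mul A
    have b3 : ∑ y ∈ Finset.univ.filter (fun y => y ∈ σ.seen ∧ s(σ.cur, y) ∉ σ.opn), T y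
        ≤ A * (1 / v) := by
      have hc2 : (Finset.univ.filter (fun y => y ∈ σ.seen ∧ s(σ.cur, y) ∉ σ.opn)).card ≤ v := by
        refine (Finset.card_le_card ?_).trans hle
        intro y hy
        exact (Finset.mem_filter.1 hy).2.1
      refine (Finset.sum_le_sum (fun y hy => hXX y (Finset.mem_filter.1 hy).2.1
        (Finset.mem_filter.1 hy).2.2)).trans ?_
      rw [Finset.sum_const, nsmul_eq_mul]
      calc _ ≤ (v : ℝ) * (A / v ^ 2) := by gcongr
          _ = A * (1 / v) := by field_simp
    rw [hsplit]
    calc _ ≤ A + (A + A * (1 / v)) := add_le_add b1 (add_le_add b2 b3)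
      _ = A * q := by rw [hq]; ring
      _ = _ := by rw [hA, pow_succ]; ring

end Walks

/-! ### Counting marks -/
section Marks
set_option linter.unusedSectionVars false
variable {β : Type} [DecidableEq β]

def fib (E : ℕ → β) (L : ℕ) (e : β) : ℕ := ((Finset.range L).filter (fun j => E j = e)).card

structure GoodM (E : ℕ → β) (L v : ℕ) (M : Finset ℕ) : Prop where
  sub : M ⊆ Finset.range L
  inj : Set.InjOn E M
  two : ∀ j ∈ M, 2 ≤ fib E L (E j)
  card : v ≤ M.card + 1

def unm (E : ℕ → β) (L : ℕ) (M : Finset ℕ) : Finset ℕ :=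
  (Finset.range L).filter (fun j => (∀ i ∈ Finset.range j, E i ≠ E j) ∧ 2 ≤ fib E L (E j) ∧
    ∀ i ∈ M, E i ≠ E j)

def uone (E : ℕ → β) (L : ℕ) : Finset β :=
  ((Finset.range L).image E).filter (fun e => fib E L e = 1)

lemma first_inj {E : ℕ → β} {i j : ℕ} (hi : ∀ k ∈ Finset.range i, E k ≠ E i)
    (hj : ∀ k ∈ Finset.range j, E k ≠ E j) (h : E i = E j) : i = j := by
  rcases lt_trichotomy i j with hlt | h' | hlt
  · exact absurd h (hj i (by simpa using hlt))
  · exact h'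
  · exact absurd h.symm (hi j (by simpa using hlt))

lemma u_bound {E : ℕ → β} {L v : ℕ} {M : Finset ℕ} (h : GoodM E L v M) :
    (uone E L).card + 2 * (unm E L M).card + 2 * M.card ≤ L := by
  have hU : Set.InjOn E (unm E L M) := by
    intro i hi j hj hij
    simp only [unm, Finset.coe_filter, Set.mem_ofPred_eq] at hi hj
    exact first_inj hi.2.1 hj.2.1 hij
  have e1 : ∑ e ∈ (Finset.range L).image E, fib E L e = L := by
    have := Finset.card_eq_sum_card_image E (Finset.range L)
    rw [Finset.card_range] at this
    exact this.symm
  have d1 : Disjoint ((unm E L M).image E) (M.image E) := by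
    rw [Finset.disjoint_left]
    intro e he he'
    simp only [Finset.mem_image] at he he'
    obtain ⟨i, hi, rfl⟩ := he
    obtain ⟨j, hj, hij⟩ := he'
    simp only [unm, Finset.mem_filter] at hi
    exact hi.2.2.2 j hj hij
  have d2 : Disjoint (uone E L) ((unm E L M).image E ∪ M.image E) := by
    rw [Finset.disjoint_left]
    intro e he he'
    simp only [uone, Finset.mem_filter] at he
    simp only [Finset.mem_union, Finset.mem_image] at he'
    rcases he' with ⟨i, hi, rfl⟩ | ⟨i, hi, rfl⟩
    · simp only [unm, Finset.mem_filter] at hi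
      omega
    · have := h.two i hi; omega
  have hsub : uone E L ∪ ((unm E L M).image E ∪ M.image E) ⊆ (Finset.range L).image E := by
    apply Finset.union_subset (Finset.filter_subset _ _)
    apply Finset.union_subset
    · exact Finset.image_subset_image (Finset.filter_subset _ _)
    · exact Finset.image_subset_image h.sub
  have h3 := Finset.sum_le_sum_of_subset (f := fib E L) hsub
  rw [e1, Finset.sum_union d2, Finset.sum_union d1, Finset.sum_image hU,
    Finset.sum_image h.inj] at h3
  have a1 : (uone E L).card ≤ ∑ e ∈ uone E L, fib E L e := by
    rw [Finset.card_eq_sum_ones]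
    apply Finset.sum_le_sum
    intro e he
    simp only [uone, Finset.mem_filter] at he
    omega
  have a2 : 2 * (unm E L M).card ≤ ∑ i ∈ unm E L M, fib E L (E i) := by
    rw [mul_comm, ← smul_eq_mul]
    apply Finset.card_nsmul_le_sum
    intro i hi
    simp only [unm, Finset.mem_filter] at hi
    exact hi.2.2.1
  have a3 : 2 * M.card ≤ ∑ i ∈ M, fib E L (E i) := by
    rw [mul_comm, ← smul_eq_mul]
    apply Finset.card_nsmul_le_sum
    exact h.two
  omega

open scoped Classical in
lemma marks_sum (E : ℕ → β) (L v : ℕ) (hv : 1 ≤ v) :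
    ∑ M ∈ (Finset.range L).powerset.filter (fun M => GoodM E L v M),
      ((v : ℝ) ^ (unm E L M).card)⁻¹ ≤ 2 ^ (L + 1 - v) * (1 + 1 / (v : ℝ)) ^ L := by
  set MM := (Finset.range L).powerset.filter (fun M => GoodM E L v M) with hMM
  rcases MM.eq_empty_or_nonempty with h0 | ⟨M0, hM0⟩
  · rw [h0, Finset.sum_empty]; positivity
  set F := (Finset.range L).filter (fun j => ∀ i ∈ Finset.range j, E i ≠ E j) with hF
  set NF := (Finset.range L).filter (fun j => ¬ ∀ i ∈ Finset.range j, E i ≠ E j) with hNF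
  have hcard : F.card + NF.card = L := by
    rw [hF, hNF, Finset.card_filter_add_card_filter_not, Finset.card_range]
  have exF : ∀ j < L, ∃ i ∈ F, E i = E j := by
    intro j hj
    induction j using Nat.strong_induction_on with
    | _ j ih =>
      by_cases hf : ∀ i ∈ Finset.range j, E i ≠ E j
      · exact ⟨j, by simp [hF, hj]; simpa using hf, rfl⟩
      · push Not at hf
        obtain ⟨i, hi, hij⟩ := hf
        have hi' := Finset.mem_range.1 hi
        obtain ⟨k, hk, hk'⟩ := ih i hi' (by omega)
        exact ⟨k, hk, hk'.trans hij⟩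
  have hFc : v ≤ F.card + 1 := by
    have h1 := (Finset.mem_filter.1 hM0).2
    have : M0.card ≤ F.card := by
      rw [← Finset.card_image_of_injOn h1.inj]
      refine (Finset.card_le_card ?_).trans (Finset.card_image_le (s := F) (f := E))
      intro e he
      obtain ⟨j, hj, rfl⟩ := Finset.mem_image.1 he
      obtain ⟨i, hi, hij⟩ := exF j (by simpa using h1.sub hj)
      exact Finset.mem_image.2 ⟨i, hi, hij⟩
    have := h1.card
    omega
  set φ : Finset ℕ → Finset ℕ × Finset ℕ := fun M => (M ∩ NF, unm E L M) with hφ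
  have hrec : ∀ M ∈ MM, ∀ j, j ∈ M ↔ (j ∈ NF ∧ j ∈ M ∩ NF) ∨ (j ∈ F ∧ 2 ≤ fib E L (E j) ∧
      j ∉ unm E L M ∧ ∀ i ∈ M ∩ NF, E i ≠ E j) := by
    intro M hM j
    have g := (Finset.mem_filter.1 hM).2
    constructor
    · intro hj
      by_cases hf : j ∈ NF
      · exact Or.inl ⟨hf, Finset.mem_inter.2 ⟨hj, hf⟩⟩
      · right
        have hjF : j ∈ F := by
          have := g.sub hj
          simp only [hF, hNF, Finset.mem_filter] at hf ⊢
          tauto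
        refine ⟨hjF, g.two j hj, ?_, ?_⟩
        · intro hu
          simp only [unm, Finset.mem_filter] at hu
          exact hu.2.2.2 j hj rfl
        · intro i hi hij
          have := g.inj (Finset.mem_inter.1 hi).1 hj hij
          subst this
          exact hf (Finset.mem_inter.1 hi).2
    · rintro (⟨_, h⟩ | ⟨h1, h2, h3, h4⟩)
      · exact (Finset.mem_inter.1 h).1
      · simp only [hF, Finset.mem_filter] at h1
        simp only [unm, Finset.mem_filter] at h3
        have : ∃ i ∈ M, E i = E j := by
          by_contra hcon
          push Not at hcon
          exact h3 ⟨h1.1, h1.2, h2, hcon⟩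
        obtain ⟨i, hi, hij⟩ := this
        by_cases hf : i ∈ NF
        · exact absurd hij (h4 i (Finset.mem_inter.2 ⟨hi, hf⟩))
        · have hiF : i ∈ F := by
            have := g.sub hi
            simp only [hF, hNF, Finset.mem_filter] at hf ⊢
            tauto
          simp only [hF, Finset.mem_filter] at hiF
          have := first_inj hiF.2 h1.2 hij
          rwa [← this]
  have hinj : Set.InjOn φ MM := by
    intro M hM M' hM' heq
    simp only [hφ, Prod.mk.injEq] at heq
    ext j
    rw [hrec M hM j, hrec M' hM' j, heq.1, heq.2]
  calc ∑ M ∈ MM, ((v : ℝ) ^ (unm E L M).card)⁻¹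
      = ∑ q ∈ MM.image φ, ((v : ℝ) ^ q.2.card)⁻¹ := by rw [Finset.sum_image hinj]
    _ ≤ ∑ q ∈ NF.powerset ×ˢ (Finset.range L).powerset, ((v : ℝ) ^ q.2.card)⁻¹ := by
        apply Finset.sum_le_sum_of_subset_of_nonneg
        · intro q hq
          obtain ⟨M, hM, rfl⟩ := Finset.mem_image.1 hq
          simp only [hφ, Finset.mem_product, Finset.mem_powerset]
          exact ⟨Finset.inter_subset_right, Finset.filter_subset _ _⟩
        · intros; positivity
    _ = 2 ^ NF.card * (1 + 1 / (v : ℝ)) ^ L := by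
        rw [Finset.sum_product]
        simp only [Finset.sum_const, Finset.card_powerset, nsmul_eq_mul]
        have := Finset.sum_pow_mul_eq_add_pow (1 / (v : ℝ)) 1 (Finset.range L)
        simp only [one_pow, mul_one, Finset.card_range] at this
        rw [add_comm, ← this]
        simp
    _ ≤ _ := by
        gcongr
        · norm_num
        · omega

end Marks

section Pairs
set_option linter.unusedSectionVars false
variable {W : Type} [DecidableEq W] [Fintype W]

/-- The `j`-th edge of the cyclic list `lab`. -/
def cE (x : W) (lab : List W) (j : ℕ) : Sym2 W :=
  s(lab.getD j x, lab.getD ((j + 1) % lab.length) x)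

lemma edgesFrom_length (x : W) (l : List W) : (edgesFrom x l).length = l.length := by
  induction l generalizing x with
  | nil => rfl
  | cons y l ih => simp [edgesFrom, ih]

lemma edgesFrom_get (x : W) (l : List W) (i : ℕ) (h : i < l.length) :
    (edgesFrom x l)[i]'(by rw [edgesFrom_length]; exact h)
      = s((x :: l)[i]'(by simp; omega), l[i]) := by
  induction l generalizing x i with
  | nil => simp at h
  | cons y l ih =>
    cases i with
    | zero => simp [edgesFrom]
    | succ i => simp [edgesFrom]; exact ih y i (by simpa using h)

lemma edgesFrom_closed (x : W) (rest : List W) :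
    edgesFrom x (rest ++ [x]) = (List.range (rest.length + 1)).map (cE x (x :: rest)) := by
  apply List.ext_getElem
  · simp [edgesFrom_length]
  · intro i h1 h2
    rw [edgesFrom_length] at h1
    rw [edgesFrom_get x _ i h1]
    simp at h1
    simp only [List.getElem_map, List.getElem_range, cE, List.length_cons]
    have key : (x :: (rest ++ [x]))[i]'(by simp; omega) = (x :: rest)[i]'(by simp; omega) := by
      simp only [← List.cons_append]
      exact List.getElem_append_left _
    rw [key, List.getD_eq_getElem _ _ (by simp; omega)]
    rcases Nat.lt_or_ge i rest.length with h | h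
    · rw [Nat.mod_eq_of_lt (by omega), List.getD_eq_getElem _ _ (by simp; omega)]
      simp [List.getElem_append, h]
    · have : i = rest.length := by omega
      subst this
      simp

lemma count_map_range (E : ℕ → Sym2 W) (L : ℕ) (e : Sym2 W) :
    ((List.range L).map E).count e = fib E L e := by
  induction L with
  | zero => simp [fib]
  | succ L ih =>
    rw [List.range_succ, List.map_append, List.count_append, ih]
    unfold fib
    rw [Finset.range_add_one, Finset.filter_insert]
    by_cases h : E L = e
    · simp [h]
    · simp [h]

def st0 (x : W) : XSt W := ⟨x, {x}, ∅⟩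

lemma st0_inv (x : W) : (st0 x).Inv := ⟨by simp [st0], by simp [st0], by simp [st0]⟩

lemma st0_Ψ (x : W) : (st0 x).Ψ = 0 := by
  simp [XSt.Ψ, XSt.pt, XSt.deg, st0]

lemma weight_bound {v w L : ℕ} (hL : L + 2 = 2 * v + w) {x : W} {rest : List W} {M : Finset ℕ}
    (hlen : rest.length + 1 = L) (hc : (x :: rest).toFinset.card = v)
    (g : GoodM (cE x (x :: rest)) L v M) :
    3 * (st0 x).xc (rest ++ [x]) + (unm (cE x (x :: rest)) L M).card ≤ 6 * w := by
  have h1 := XSt.counts (st0_inv x) (rest ++ [x])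
  have hs : ((st0 x).run (rest ++ [x])).seen.card = v := by
    rw [XSt.seen_run, ← hc]
    congr 1
    ext z; simp [st0]; try tauto
  rw [hs] at h1
  have h2 : ((st0 x).run (rest ++ [x])).opn.card ≤ (uone (cE x (x :: rest)) L).card := by
    apply Finset.card_le_card
    intro e he
    have := XSt.opn_count (st0_inv x) [] (rest ++ [x]) (by simp [st0]) (by simp) e he
    have hx : (st0 x).cur = x := rfl
    rw [List.nil_append, hx, edgesFrom_closed, count_map_range, hlen] at this
    simp only [uone, Finset.mem_filter]
    refine ⟨?_, this⟩
    have hpos : 0 < fib (cE x (x :: rest)) L e := by omega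
    obtain ⟨j, hj⟩ := Finset.card_pos.1 hpos
    rw [Finset.mem_filter] at hj
    exact Finset.mem_image.2 ⟨j, hj.1, hj.2⟩
  have h3 := u_bound g
  have h4 := g.card
  simp [st0] at h1
  simp only [st0] at h2 ⊢
  omega

lemma pair_count (v w L : ℕ) (hv : 1 ≤ v) (hL : L + 2 = 2 * v + w)
    (S : Finset (W × List W × Finset ℕ))
    (hS : ∀ q ∈ S, q.2.1.length + 1 = L ∧ (q.1 :: q.2.1).toFinset.card = v ∧
      GoodM (cE q.1 (q.1 :: q.2.1)) L v q.2.2) :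
    (S.card : ℝ) ≤ (v : ℝ) ^ (6 * w) * ((Fintype.card W : ℝ) ^ v * (2 + 1 / (v : ℝ)) ^ L)
      * (2 ^ (L + 1 - v) * (1 + 1 / (v : ℝ)) ^ L) := by
  classical
  have hv1 : (1 : ℝ) ≤ v := by exact_mod_cast hv
  have hv0 : (0 : ℝ) < v := by linarith
  set B : ℝ := 2 ^ (L + 1 - v) * (1 + 1 / (v : ℝ)) ^ L with hB
  have hB0 : 0 ≤ B := by positivity
  set MM : W → List W → Finset (Finset ℕ) := fun x rest =>
    (Finset.range L).powerset.filter (fun M => GoodM (cE x (x :: rest)) L v M) with hMM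
  set wt : W → List W → Finset ℕ → ℝ := fun x rest M =>
    walkW v (st0 x) (rest ++ [x]) * ((v : ℝ) ^ (unm (cE x (x :: rest)) L M).card)⁻¹ with hwt
  have hwt0 : ∀ x r M, 0 ≤ wt x r M := by
    intro x r M
    exact mul_nonneg (walkW_nonneg _ _ _) (by positivity)
  rcases Nat.eq_zero_or_pos L with hL0 | hLpos
  · have : S = ∅ := by
      rw [Finset.eq_empty_iff_forall_notMem]
      intro q hq
      have := (hS q hq).1
      omega
    rw [this]; simp; positivity
  have one_le : ∀ q ∈ S, (1 : ℝ) ≤ (v : ℝ) ^ (6 * w) * wt q.1 q.2.1 q.2.2 := by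
    intro q hq
    obtain ⟨h1, h2, h3⟩ := hS q hq
    have hb := weight_bound hL h1 h2 h3
    simp only [hwt]
    unfold walkW
    have hs : ((st0 q.1).run (q.2.1 ++ [q.1])).seen.card = v := by
      rw [XSt.seen_run, ← h2]
      congr 1
      ext z; simp [st0]; try tauto
    rw [if_pos hs, ← mul_inv, ← pow_add, ← div_eq_mul_inv, le_div_iff₀ (by positivity), one_mul]
    exact pow_le_pow_right₀ hv1 hb
  have hsum : (S.card : ℝ) ≤ ∑ q ∈ S, (v : ℝ) ^ (6 * w) * wt q.1 q.2.1 q.2.2 := by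
    rw [Finset.card_eq_sum_ones]; push_cast
    exact Finset.sum_le_sum one_le
  have hbig : ∑ q ∈ S, wt q.1 q.2.1 q.2.2
      ≤ ∑ x : W, ∑ r ∈ listsOf W (L - 1), ∑ M ∈ MM x r, wt x r M := by
    have : ∑ x : W, ∑ r ∈ listsOf W (L - 1), ∑ M ∈ MM x r, wt x r M
        = ∑ q ∈ (Finset.univ : Finset W).sigma (fun x => (listsOf W (L - 1)).sigma (MM x)),
          wt q.1 q.2.1 q.2.2 := by
      rw [Finset.sum_sigma]
      apply Finset.sum_congr rfl
      intro x _
      rw [Finset.sum_sigma]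
    rw [this]
    let ψ : W × List W × Finset ℕ → (Σ _ : W, Σ _ : List W, Finset ℕ) := fun q => ⟨q.1, q.2.1, q.2.2⟩
    have hψ : Set.InjOn ψ S := by
      rintro ⟨a, b, c⟩ _ ⟨a', b', c'⟩ _ hh
      simp only [ψ, Sigma.mk.injEq, heq_eq_eq] at hh
      obtain ⟨rfl, rfl, rfl⟩ := hh
      rfl
    calc ∑ q ∈ S, wt q.1 q.2.1 q.2.2 = ∑ q ∈ S.image ψ, wt q.1 q.2.1 q.2.2 := by
          rw [Finset.sum_image hψ]
      _ ≤ _ := by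
          apply Finset.sum_le_sum_of_subset_of_nonneg
          · intro q hq
            obtain ⟨q', hq', rfl⟩ := Finset.mem_image.1 hq
            obtain ⟨h1, h2, h3⟩ := hS q' hq'
            simp only [ψ, Finset.mem_sigma, Finset.mem_univ, true_and, mem_listsOf]
            refine ⟨by omega, ?_⟩
            simp only [hMM, Finset.mem_filter, Finset.mem_powerset]
            exact ⟨h3.sub, h3⟩
          · intros; exact hwt0 _ _ _
  have hinner : ∀ x : W, ∑ r ∈ listsOf W (L - 1), ∑ M ∈ MM x r, wt x r M
      ≤ B * ∑ l ∈ listsOf W L, walkW v (st0 x) l := by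
    intro x
    calc _ ≤ ∑ r ∈ listsOf W (L - 1), walkW v (st0 x) (r ++ [x]) * B := by
          apply Finset.sum_le_sum
          intro r _
          simp only [hwt]
          rw [← Finset.mul_sum]
          exact mul_le_mul_of_nonneg_left (marks_sum _ L v hv) (walkW_nonneg _ _ _)
      _ = B * ∑ l ∈ (listsOf W (L - 1)).image (fun r => r ++ [x]), walkW v (st0 x) l := by
          rw [Finset.sum_image, ← Finset.sum_mul, mul_comm]
          intro a _ b _ hab
          simpa using hab
      _ ≤ _ := by
          apply mul_le_mul_of_nonneg_left _ hB0
          apply Finset.sum_le_sum_of_subset_of_nonneg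
          · intro l hl
            obtain ⟨r, hr, rfl⟩ := Finset.mem_image.1 hl
            rw [mem_listsOf] at hr ⊢
            simp; omega
          · intros; exact walkW_nonneg _ _ _
  have hwalk : ∑ x : W, ∑ l ∈ listsOf W L, walkW v (st0 x) l
      ≤ (Fintype.card W : ℝ) ^ v * (2 + 1 / (v : ℝ)) ^ L := by
    rcases isEmpty_or_nonempty W with hW | hW
    · simp; positivity
    have hN : (0 : ℝ) < Fintype.card W := by exact_mod_cast Fintype.card_pos
    calc _ ≤ ∑ x : W, ((Fintype.card W : ℝ) ^ v * (2 + 1 / (v : ℝ)) ^ L) / Fintype.card W := by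
          apply Finset.sum_le_sum
          intro x _
          have := walk_sum v hv L (st0 x) (st0_inv x) (by simpa [st0] using hv)
          rw [st0_Ψ] at this
          have hs : (st0 x).seen.card = 1 := by simp [st0]
          rw [hs, pow_one, pow_zero, mul_one] at this
          rw [le_div_iff₀ hN, mul_comm]
          exact this
      _ = _ := by
          rw [Finset.sum_const, nsmul_eq_mul, Finset.card_univ]; field_simp
  calc (S.card : ℝ) ≤ _ := hsum
    _ = (v : ℝ) ^ (6 * w) * ∑ q ∈ S, wt q.1 q.2.1 q.2.2 := by rw [Finset.mul_sum]
    _ ≤ (v : ℝ) ^ (6 * w) * ∑ x : W, (B * ∑ l ∈ listsOf W L, walkW v (st0 x) l) := by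
        apply mul_le_mul_of_nonneg_left _ (by positivity)
        exact hbig.trans (Finset.sum_le_sum (fun x _ => hinner x))
    _ = (v : ℝ) ^ (6 * w) * (∑ x : W, ∑ l ∈ listsOf W L, walkW v (st0 x) l) * B := by
        rw [← Finset.mul_sum]; ring
    _ ≤ _ := by gcongr
end Pairs

/-! ### Binary forests -/
section Forest

inductive BT : Type
  | leaf : BT
  | node : BT → BT → BT

def BT.lv : BT → ℕ
  | .leaf => 1
  | .node l r => l.lv + r.lv

def BT.enc : BT → List Bool
  | .leaf => [false]
  | .node l r => true :: (l.enc ++ r.enc)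

def BT.idx : BT → ℕ → List (ℕ × ℕ × ℕ)
  | .leaf, _ => []
  | .node l r, a => (a, a + l.lv + r.lv, a + l.lv) :: (l.idx a ++ r.idx (a + l.lv))

def flv : List BT → ℕ
  | [] => 0
  | t :: Φ => t.lv + flv Φ

def fenc : List BT → List Bool
  | [] => []
  | t :: Φ => t.enc ++ fenc Φ

def fidx : List BT → ℕ → List (ℕ × ℕ × ℕ)
  | [], _ => []
  | t :: Φ, a => t.idx a ++ fidx Φ (a + t.lv)

lemma BT.enc_length (t : BT) : t.enc.length + 1 = 2 * t.lv := by
  induction t with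
  | leaf => rfl
  | node l r h1 h2 => simp [BT.enc, BT.lv]; omega

lemma fenc_length (Φ : List BT) : (fenc Φ).length + Φ.length = 2 * flv Φ := by
  induction Φ with
  | nil => rfl
  | cons t Φ ih => have := t.enc_length; simp [fenc, flv]; omega

lemma BT.enc_inj (t t' : BT) (r r' : List Bool) (h : t.enc ++ r = t'.enc ++ r') :
    t = t' ∧ r = r' := by
  induction t generalizing t' r r' with
  | leaf =>
    cases t' with
    | leaf => simpa [BT.enc] using h
    | node a b => simp [BT.enc] at h
  | node a b iha ihb =>
    cases t' with
    | leaf => simp [BT.enc] at h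
    | node a' b' =>
      simp only [BT.enc, List.cons_append, List.cons.injEq, true_and, List.append_assoc] at h
      obtain ⟨rfl, h1⟩ := iha _ _ _ h
      obtain ⟨rfl, h2⟩ := ihb _ _ _ h1
      exact ⟨rfl, h2⟩

lemma fenc_inj (Φ Φ' : List BT) (hl : Φ.length = Φ'.length) (h : fenc Φ = fenc Φ') : Φ = Φ' := by
  induction Φ generalizing Φ' with
  | nil => cases Φ' with
    | nil => rfl
    | cons t Φ' => simp at hl
  | cons t Φ ih => cases Φ' with
    | nil => simp at hl
    | cons t' Φ' =>
      simp only [fenc] at h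
      obtain ⟨rfl, h2⟩ := BT.enc_inj _ _ _ _ h
      rw [ih Φ' (by simpa using hl) h2]

lemma card_listsOf {W : Type} [Fintype W] [DecidableEq W] (k : ℕ) :
    (listsOf W k).card = Fintype.card W ^ k := by
  induction k with
  | zero => simp [listsOf]
  | succ k ih =>
    rw [listsOf, Finset.card_image_of_injective, Finset.card_product, ih, pow_succ, mul_comm,
      Finset.card_univ]
    rintro ⟨a, b⟩ ⟨c, d⟩ hh
    simpa using hh

lemma forest_finset (l L : ℕ) : ∃ S : Finset (List BT), (∀ Φ, Φ.length = l → flv Φ = L → Φ ∈ S) ∧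
    S.card ≤ 2 ^ (2 * L - l) := by
  classical
  set T : Set (List BT) := {Φ | Φ.length = l ∧ flv Φ = L} with hT
  have hinj : Set.InjOn fenc T := by
    intro a ha b hb hab
    exact fenc_inj a b (ha.1.trans hb.1.symm) hab
  have hmaps : Set.MapsTo fenc T (listsOf Bool (2 * L - l)) := by
    intro a ha
    simp only [Finset.mem_coe, mem_listsOf]
    have := fenc_length a
    have h1 := ha.1
    have h2 := ha.2
    omega
  have hfin : T.Finite := Set.Finite.of_injOn hmaps hinj (Finset.finite_toSet _)
  refine ⟨hfin.toFinset, ?_, ?_⟩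
  · intro Φ h1 h2
    simp [hT, h1, h2]
  · have := Finset.card_le_card_of_injOn (s := hfin.toFinset) (t := listsOf Bool (2 * L - l)) fenc
      (by intro a ha; exact hmaps (by simpa using ha)) (by simpa using hinj)
    rwa [card_listsOf, Fintype.card_bool] at this

/-- The face sets given by index triples. -/
def FS (B : ℕ → ℕ) (l : List (ℕ × ℕ × ℕ)) : Set (Finset ℕ) :=
  {t | ∃ q ∈ l, t = ({B q.1, B q.2.1, B q.2.2} : Finset ℕ)}

lemma FS_nil (B : ℕ → ℕ) : FS B [] = ∅ := by
  ext t; simp [FS]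

lemma FS_cons (B : ℕ → ℕ) (q l) : FS B (q :: l) = {({B q.1, B q.2.1, B q.2.2} : Finset ℕ)} ∪ FS B l := by
  ext t; simp [FS]

lemma FS_append (B : ℕ → ℕ) (l l') : FS B (l ++ l') = FS B l ∪ FS B l' := by
  ext t
  simp only [FS, List.mem_append, Set.mem_union, Set.mem_ofPred_eq]
  constructor
  · rintro ⟨q, h | h, rfl⟩
    · exact Or.inl ⟨q, h, rfl⟩
    · exact Or.inr ⟨q, h, rfl⟩
  · rintro (⟨q, h, rfl⟩ | ⟨q, h, rfl⟩)
    · exact ⟨q, Or.inl h, rfl⟩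
    · exact ⟨q, Or.inr h, rfl⟩

variable {B B' : ℕ → ℕ} {i m N : ℕ}

lemma BT.FS_same (h1 : ∀ j ≤ i, B' j = B j) (t : BT) (a : ℕ) (h : a + t.lv ≤ i) :
    FS B' (t.idx a) = FS B (t.idx a) := by
  induction t generalizing a with
  | leaf => simp [BT.idx, FS_nil]
  | node l r hl hr =>
    simp only [BT.lv] at h
    simp only [BT.idx, FS_cons, FS_append]
    rw [hl a (by omega), hr (a + l.lv) (by omega), h1 _ (by omega), h1 _ (by omega), h1 _ (by omega)]

lemma BT.FS_shift (h3 : ∀ j, i + 1 ≤ j → j ≤ N → B' (j + 1) = B j) (t : BT) (a : ℕ)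
    (ha : i < a) (h : a + t.lv ≤ N) : FS B' (t.idx (a + 1)) = FS B (t.idx a) := by
  induction t generalizing a with
  | leaf => simp [BT.idx, FS_nil]
  | node l r hl hr =>
    simp only [BT.lv] at h
    simp only [BT.idx, FS_cons, FS_append]
    have e1 : a + 1 + l.lv = (a + l.lv) + 1 := by omega
    have e2 : a + l.lv + 1 + r.lv = (a + l.lv + r.lv) + 1 := by omega
    rw [e1, e2, hl a ha (by omega), hr (a + l.lv) (by omega) (by omega), h3 _ (by omega) (by omega),
      h3 _ (by omega) (by omega), h3 _ (by omega) (by omega)]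

lemma BT.lv_pos (t : BT) : 0 < t.lv := by
  induction t with
  | leaf => simp [BT.lv]
  | node l r hl hr => simp [BT.lv]; omega

lemma BT.graft (h1 : ∀ j ≤ i, B' j = B j) (h2 : B' (i + 1) = m)
    (h3 : ∀ j, i + 1 ≤ j → j ≤ N → B' (j + 1) = B j) (t : BT) (a : ℕ)
    (ha : a ≤ i) (hi : i < a + t.lv) (h : a + t.lv ≤ N) :
    ∃ t' : BT, t'.lv = t.lv + 1 ∧
      FS B' (t'.idx a) = {({B i, B (i + 1), m} : Finset ℕ)} ∪ FS B (t.idx a) := by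
  induction t generalizing a with
  | leaf =>
    simp only [BT.lv] at hi h
    have : a = i := by omega
    subst this
    refine ⟨.node .leaf .leaf, rfl, ?_⟩
    simp only [BT.idx, FS_cons, FS_nil, BT.lv, List.nil_append]
    rw [h1 a le_rfl, h2, h3 (a + 1) le_rfl h]
  | node l r hl hr =>
    simp only [BT.lv] at hi h
    have hlp := l.lv_pos
    have hrp := r.lv_pos
    rcases Nat.lt_or_ge i (a + l.lv) with hlt | hge
    · obtain ⟨l', e1, e2⟩ := hl a ha hlt (by omega)
      refine ⟨.node l' r, by simp [BT.lv, e1]; omega, ?_⟩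
      simp only [BT.idx, FS_cons, FS_append, e1, e2]
      have x1 : a + (l.lv + 1) = (a + l.lv) + 1 := by omega
      have x2 : a + l.lv + 1 + r.lv = (a + l.lv + r.lv) + 1 := by omega
      rw [x1, x2, BT.FS_shift h3 r (a + l.lv) (by omega) (by omega), h1 _ (by omega),
        h3 _ (by omega) (by omega), h3 _ (by omega) (by omega)]
      ext t; simp only [Set.mem_union]; tauto
    · obtain ⟨r', e1, e2⟩ := hr (a + l.lv) hge (by omega) (by omega)
      refine ⟨.node l r', by simp [BT.lv, e1]; omega, ?_⟩
      simp only [BT.idx, FS_cons, FS_append, e1, e2]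
      have x2 : a + l.lv + (r.lv + 1) = (a + l.lv + r.lv) + 1 := by omega
      rw [x2, BT.FS_same h1 l a (by omega), h1 a (by omega), h1 (a + l.lv) (by omega),
        h3 _ (by omega) (by omega)]
      ext t; simp only [Set.mem_union]; tauto

lemma forest_shift (h3 : ∀ j, i + 1 ≤ j → j ≤ N → B' (j + 1) = B j) (Φ : List BT) (a : ℕ)
    (ha : i < a) (h : a + flv Φ ≤ N) : FS B' (fidx Φ (a + 1)) = FS B (fidx Φ a) := by
  induction Φ generalizing a with
  | nil => simp [fidx, FS_nil]
  | cons t Φ ih =>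
    simp only [flv] at h
    simp only [fidx, FS_append]
    have e1 : a + 1 + t.lv = (a + t.lv) + 1 := by omega
    rw [e1, BT.FS_shift h3 t a ha (by omega), ih (a + t.lv) (by omega) (by omega)]

lemma forest_graft (h1 : ∀ j ≤ i, B' j = B j) (h2 : B' (i + 1) = m)
    (h3 : ∀ j, i + 1 ≤ j → j ≤ N → B' (j + 1) = B j) (Φ : List BT) (a : ℕ)
    (ha : a ≤ i) (hi : i < a + flv Φ) (h : a + flv Φ ≤ N) :
    ∃ Φ' : List BT, Φ'.length = Φ.length ∧ flv Φ' = flv Φ + 1 ∧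
      FS B' (fidx Φ' a) = {({B i, B (i + 1), m} : Finset ℕ)} ∪ FS B (fidx Φ a) := by
  induction Φ generalizing a with
  | nil => simp [flv] at hi; omega
  | cons t Φ ih =>
    simp only [flv] at hi h
    rcases Nat.lt_or_ge i (a + t.lv) with hlt | hge
    · obtain ⟨t', e1, e2⟩ := BT.graft h1 h2 h3 t a ha hlt (by omega)
      refine ⟨t' :: Φ, rfl, by simp [flv, e1]; omega, ?_⟩
      simp only [fidx, FS_append, e1, e2]
      have x1 : a + (t.lv + 1) = (a + t.lv) + 1 := by omega
      rw [x1, forest_shift h3 Φ (a + t.lv) (by omega) (by omega), Set.union_assoc]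
    · obtain ⟨Φ', e0, e1, e2⟩ := ih (a + t.lv) hge (by omega) (by omega)
      refine ⟨t :: Φ', by simp [e0], by simp [flv, e1]; omega, ?_⟩
      simp only [fidx, FS_append, e2]
      rw [BT.FS_same h1 t a (by omega)]
      ext t; simp only [Set.mem_union]; tauto

lemma forest_init (l a : ℕ) (B : ℕ → ℕ) : FS B (fidx (List.replicate l BT.leaf) a) = ∅ := by
  induction l generalizing a with
  | zero => simp [fidx, FS_nil]
  | succ l ih => simp [List.replicate_succ, fidx, FS_append, BT.idx, FS_nil, ih]

lemma flv_init (l : ℕ) : flv (List.replicate l BT.leaf) = l := by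
  induction l with
  | zero => rfl
  | succ l ih => simp [List.replicate_succ, flv, ih, BT.lv]; omega

end Forest

/-! ### Probability that a set of edges is present -/
open scoped Classical in
lemma prob_le (n : ℕ) (p : ℝ) (hp0 : 0 ≤ p) (hp1 : p ≤ 1) (F : Finset (Sym2 (Fin n))) :
    ∑ G : SimpleGraph (Fin n), (if ∀ e ∈ F, e ∈ G.edgeSet then
      (p ^ edgeCard G * (1 - p) ^ (n.choose 2 - edgeCard G)) else 0) ≤ p ^ F.card := by
  have hq0 : 0 ≤ 1 - p := by linarith
  rw [← Finset.sum_filter]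
  set GG := (Finset.univ : Finset (SimpleGraph (Fin n))).filter (fun G => ∀ e ∈ F, e ∈ G.edgeSet)
    with hGG
  rcases GG.eq_empty_or_nonempty with h0 | ⟨G0, hG0⟩
  · rw [h0, Finset.sum_empty]; positivity
  set E0 := (⊤ : SimpleGraph (Fin n)).edgeFinset with hE0
  have hcE : E0.card = n.choose 2 := by
    rw [hE0, SimpleGraph.card_edgeFinset_top_eq_card_choose_two, Fintype.card_fin]
  have hsub : ∀ G : SimpleGraph (Fin n), G.edgeFinset ⊆ E0 := by
    intro G
    rw [hE0]
    exact SimpleGraph.edgeFinset_mono le_top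
  have hF : ∀ G ∈ GG, F ⊆ G.edgeFinset := by
    intro G hG e he
    rw [SimpleGraph.mem_edgeFinset]
    exact (Finset.mem_filter.1 hG).2 e he
  have hFE : F ⊆ E0 := (hF G0 hG0).trans (hsub G0)
  have hec : ∀ G : SimpleGraph (Fin n), edgeCard G = G.edgeFinset.card := by
    intro G
    unfold edgeCard
    rw [Nat.card_eq_fintype_card, SimpleGraph.edgeFinset_card]
  have hinj : Set.InjOn (fun G : SimpleGraph (Fin n) => G.edgeFinset \ F) GG := by
    intro G hG G' hG' heq
    simp only at heq
    have : G.edgeFinset = G'.edgeFinset := by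
      rw [← Finset.sdiff_union_of_subset (hF G hG), heq, Finset.sdiff_union_of_subset (hF G' hG')]
    exact SimpleGraph.edgeFinset_inj.1 this
  have hterm : ∀ G ∈ GG, p ^ edgeCard G * (1 - p) ^ (n.choose 2 - edgeCard G)
      = p ^ F.card * (p ^ (G.edgeFinset \ F).card *
        (1 - p) ^ ((E0 \ F).card - (G.edgeFinset \ F).card)) := by
    intro G hG
    rw [hec, ← hcE]
    have e1 := Finset.card_sdiff_add_card_eq_card (hF G hG)
    have e2 := Finset.card_sdiff_add_card_eq_card hFE
    rw [← mul_assoc, ← pow_add]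
    congr 2 <;> omega
  rw [Finset.sum_congr rfl hterm, ← Finset.mul_sum]
  refine mul_le_of_le_one_right (by positivity) ?_
  calc _ = ∑ T ∈ GG.image (fun G : SimpleGraph (Fin n) => G.edgeFinset \ F),
        p ^ T.card * (1 - p) ^ ((E0 \ F).card - T.card) := by rw [Finset.sum_image hinj]
    _ ≤ ∑ T ∈ (E0 \ F).powerset, p ^ T.card * (1 - p) ^ ((E0 \ F).card - T.card) := by
        apply Finset.sum_le_sum_of_subset_of_nonneg
        · intro T hT
          obtain ⟨G, hG, rfl⟩ := Finset.mem_image.1 hT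
          rw [Finset.mem_powerset]
          exact Finset.sdiff_subset_sdiff (hsub G) subset_rfl
        · intros; positivity
    _ = 1 := by rw [Finset.sum_pow_mul_eq_add_pow]; simp

set_option linter.unusedSectionVars false

/-! ### Geometry of diagrams -/
section Geometry
variable {V : Type} [Fintype V] [DecidableEq V]

/-- The `j`-th boundary vertex (cyclically indexed). -/
def Bd (D : DiagState V) (j : ℕ) : ℕ := D.boundary.getD (j % D.boundary.length) 0

/-- The label pair of the `j`-th boundary edge. -/
def edgeLbl (D : DiagState V) (j : ℕ) : Sym2 V := s(D.label (Bd D j), D.label (Bd D (j + 1)))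

structure DS (l : ℕ) (D : DiagState V) : Prop where
  nodup : D.boundary.Nodup
  mem : ∀ i, i ∈ D.boundary ↔ i < D.nv
  mkd : ∀ e ∈ D.marked, ∃ j < D.boundary.length, e = s(Bd D j, Bd D (j + 1))
  fr : ∃ Φ, Φ.length = l ∧ flv Φ = D.boundary.length ∧ faceSets D = FS (Bd D) (fidx Φ 0)

lemma Bd_eq {D : DiagState V} {j : ℕ} (hj : j < D.boundary.length) : Bd D j = D.boundary[j] := by
  simp [Bd, Nat.mod_eq_of_lt hj, hj]

lemma Bd_getD {D : DiagState V} {j : ℕ} (hj : j < D.boundary.length) :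
    D.boundary.getD j 0 = Bd D j := by
  simp [Bd, Nat.mod_eq_of_lt hj]

lemma Bd_mem {D : DiagState V} (h : 0 < D.boundary.length) (j : ℕ) : Bd D j ∈ D.boundary := by
  have := Nat.mod_lt j h
  simp only [Bd, List.getD_eq_getElem _ _ this]
  exact List.getElem_mem _

lemma glue_length (D : DiagState V) (i : ℕ) (c : V) (hi : i < D.boundary.length) :
    (glueResult D i c).boundary.length = D.boundary.length + 1 := by
  simp [glueResult]; omega

lemma glue_le (D : DiagState V) (i : ℕ) (c : V) (hi : i < D.boundary.length) (j : ℕ) (hj : j ≤ i) :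
    Bd (glueResult D i c) j = Bd D j := by
  have h1 : j < (glueResult D i c).boundary.length := by rw [glue_length _ _ _ hi]; omega
  rw [Bd_eq h1, Bd_eq (by omega)]
  simp only [glueResult]
  rw [List.getElem_append_left (by simp; omega)]
  simp

lemma glue_mid (D : DiagState V) (i : ℕ) (c : V) (hi : i < D.boundary.length) :
    Bd (glueResult D i c) (i + 1) = D.nv := by
  have h1 : i + 1 < (glueResult D i c).boundary.length := by rw [glue_length _ _ _ hi]; omega
  rw [Bd_eq h1]
  simp only [glueResult]
  rw [List.getElem_append_right (by simp)]
  have : i + 1 - (List.take (i + 1) D.boundary).length = 0 := by simp; omega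
  simp only [this, List.getElem_cons_zero]

lemma glue_gt (D : DiagState V) (i : ℕ) (c : V) (hi : i < D.boundary.length) (j : ℕ)
    (hj : i + 1 ≤ j) (hj2 : j ≤ D.boundary.length) :
    Bd (glueResult D i c) (j + 1) = Bd D j := by
  rcases hj2.lt_or_eq with hj2 | hj2
  · have h1 : j + 1 < (glueResult D i c).boundary.length := by rw [glue_length _ _ _ hi]; omega
    rw [Bd_eq h1, Bd_eq (by omega)]
    simp only [glueResult]
    rw [List.getElem_append_right (by simp; omega)]
    have : j + 1 - (List.take (i + 1) D.boundary).length = (j - (i + 1)) + 1 := by simp; omega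
    simp only [this, List.getElem_cons_succ, List.getElem_drop]
    congr 1; omega
  · have e1 : Bd (glueResult D i c) (j + 1) = Bd (glueResult D i c) 0 := by
      rw [hj2]; unfold Bd; rw [glue_length _ _ _ hi]; simp
    have e2 : Bd D j = Bd D 0 := by rw [hj2]; unfold Bd; simp
    rw [e1, e2, glue_le _ _ _ hi _ (Nat.zero_le _)]

lemma glueResult_eq (D : DiagState V) (i : ℕ) (c : V) (hi : i < D.boundary.length) :
    (glueResult D i c).marked = glueMarked D (Bd D i) (Bd D (i + 1)) c ∧
    (glueResult D i c).faces = (Bd D i, Bd D (i + 1), D.nv) :: D.faces := by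
  simp [glueResult, Bd, Nat.mod_eq_of_lt hi]

lemma DS.glue {l : ℕ} {D : DiagState V} (h : DS l D) (i : ℕ) (c : V) (hi : i < D.boundary.length) :
    DS l (glueResult D i c) := by
  have hm := (glueResult_eq D i c hi).1
  have hf := (glueResult_eq D i c hi).2
  have hlen := glue_length D i c hi
  have hperm : (glueResult D i c).boundary.Perm (D.nv :: D.boundary) := by
    simp only [glueResult]
    refine List.perm_middle.trans ?_
    rw [List.take_append_drop]
  refine ⟨?_, ?_, ?_, ?_⟩
  · rw [hperm.nodup_iff, List.nodup_cons]
    exact ⟨by rw [h.mem]; omega, h.nodup⟩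
  · intro k
    rw [hperm.mem_iff, List.mem_cons, h.mem]
    simp only [glueResult]; omega
  · intro e he
    rw [hm] at he
    rw [hlen]
    rcases he with ⟨he, hne⟩ | ⟨he, -⟩ | ⟨he, -⟩
    · obtain ⟨j, hj, rfl⟩ := h.mkd e he
      have hji : j ≠ i := by rintro rfl; exact hne rfl
      rcases lt_or_gt_of_ne hji with hlt | hlt
      · exact ⟨j, by omega, by rw [glue_le _ _ _ hi _ hlt.le, glue_le _ _ _ hi _ hlt]⟩
      · exact ⟨j + 1, by omega, by rw [glue_gt _ _ _ hi _ hlt (by omega), glue_gt _ _ _ hi (j+1) (by omega) (by omega)]⟩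
    · exact ⟨i, by omega, by rw [he, glue_le _ _ _ hi _ le_rfl, glue_mid _ _ _ hi]⟩
    · exact ⟨i + 1, by omega, by rw [he, glue_gt _ _ _ hi _ le_rfl (by omega), glue_mid _ _ _ hi, Sym2.eq_swap]⟩
  · obtain ⟨Φ, h1, h2, h3⟩ := h.fr
    obtain ⟨Φ', g1, g2, g3⟩ := forest_graft (B := Bd D) (B' := Bd (glueResult D i c)) (i := i) (m := D.nv)
      (N := D.boundary.length) (fun j hj => glue_le D i c hi j hj) (glue_mid D i c hi)
      (fun j hj hj2 => glue_gt D i c hi j hj hj2) Φ 0 (Nat.zero_le _) (by omega) (by omega)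
    refine ⟨Φ', by omega, by omega, ?_⟩
    rw [g3, ← h3]
    ext t
    simp [faceSets, hf]

lemma glue_label_old {l : ℕ} {D : DiagState V} (h : DS l D) (i : ℕ) (c : V) {k : ℕ} (hk : k < D.nv) :
    (glueResult D i c).label k = D.label k := by
  simp only [glueResult]
  rw [Function.update_of_ne (by omega)]

lemma glue_label_new (D : DiagState V) (i : ℕ) (c : V) :
    (glueResult D i c).label D.nv = c := by
  simp [glueResult]

lemma DS.Bd_lt {l : ℕ} {D : DiagState V} (h : DS l D) (h0 : 0 < D.boundary.length) (j : ℕ) :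
    Bd D j < D.nv := (h.mem _).1 (Bd_mem h0 j)

lemma edgeLbl_lt {l : ℕ} {D : DiagState V} (h : DS l D) (i : ℕ) (c : V) (hi : i < D.boundary.length)
    (j : ℕ) (hj : j < i) : edgeLbl (glueResult D i c) j = edgeLbl D j := by
  have h0 : 0 < D.boundary.length := by omega
  unfold edgeLbl
  rw [glue_le _ _ _ hi _ hj.le, glue_le _ _ _ hi _ hj, glue_label_old h _ _ (h.Bd_lt h0 _),
    glue_label_old h _ _ (h.Bd_lt h0 _)]

lemma edgeLbl_i {l : ℕ} {D : DiagState V} (h : DS l D) (i : ℕ) (c : V) (hi : i < D.boundary.length)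
    : edgeLbl (glueResult D i c) i = s(D.label (Bd D i), c) := by
  have h0 : 0 < D.boundary.length := by omega
  unfold edgeLbl
  rw [glue_le _ _ _ hi _ le_rfl, glue_mid _ _ _ hi, glue_label_old h _ _ (h.Bd_lt h0 _),
    glue_label_new]

lemma edgeLbl_i1 {l : ℕ} {D : DiagState V} (h : DS l D) (i : ℕ) (c : V) (hi : i < D.boundary.length)
    : edgeLbl (glueResult D i c) (i + 1) = s(D.label (Bd D (i + 1)), c) := by
  have h0 : 0 < D.boundary.length := by omega
  unfold edgeLbl
  rw [glue_gt _ _ _ hi _ le_rfl hi, glue_mid _ _ _ hi, glue_label_old h _ _ (h.Bd_lt h0 _),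
    glue_label_new, Sym2.eq_swap]

lemma edgeLbl_gt {l : ℕ} {D : DiagState V} (h : DS l D) (i : ℕ) (c : V) (hi : i < D.boundary.length)
    (j : ℕ) (hj : i < j) (hj2 : j < D.boundary.length) :
    edgeLbl (glueResult D i c) (j + 1) = edgeLbl D j := by
  have h0 : 0 < D.boundary.length := by omega
  unfold edgeLbl
  rw [glue_gt _ _ _ hi _ hj hj2.le, glue_gt _ _ _ hi (j+1) (by omega) hj2, glue_label_old h _ _ (h.Bd_lt h0 _),
    glue_label_old h _ _ (h.Bd_lt h0 _)]

/-- Positions after gluing: old ones or the two new ones. -/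
lemma edgeLbl_cases {l : ℕ} {D : DiagState V} (h : DS l D) (i : ℕ) (c : V) (hi : i < D.boundary.length)
    (j : ℕ) (hj : j < D.boundary.length + 1) :
    (∃ k < D.boundary.length, k ≠ i ∧ edgeLbl (glueResult D i c) j = edgeLbl D k) ∨
    edgeLbl (glueResult D i c) j = s(D.label (Bd D i), c) ∨
    edgeLbl (glueResult D i c) j = s(D.label (Bd D (i + 1)), c) := by
  rcases lt_trichotomy j i with hlt | rfl | hgt
  · exact Or.inl ⟨j, by omega, by omega, edgeLbl_lt h i c hi j hlt⟩
  · exact Or.inr (Or.inl (edgeLbl_i h j c hi))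
  · rcases Nat.lt_or_ge (i+1) j with h2 | h2
    · obtain ⟨k, rfl⟩ : ∃ k, j = k + 1 := ⟨j - 1, by omega⟩
      exact Or.inl ⟨k, by omega, by omega, edgeLbl_gt h i c hi k (by omega) (by omega)⟩
    · have : j = i + 1 := by omega
      subst this
      exact Or.inr (Or.inr (edgeLbl_i1 h i c hi))

lemma fib_glue {l : ℕ} {D : DiagState V} (h : DS l D) (i : ℕ) (c : V) (hi : i < D.boundary.length)
    (e : Sym2 V) :
    fib (edgeLbl (glueResult D i c)) (D.boundary.length + 1) e + (if edgeLbl D i = e then 1 else 0) =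
    fib (edgeLbl D) D.boundary.length e + (if s(D.label (Bd D i), c) = e then 1 else 0)
      + (if s(D.label (Bd D (i + 1)), c) = e then 1 else 0) := by
  unfold fib
  simp only [Finset.card_filter]
  obtain ⟨m, hm⟩ : ∃ m, D.boundary.length = i + 1 + m := ⟨D.boundary.length - (i+1), by omega⟩
  have e1 : D.boundary.length + 1 = (i + 2) + m := by omega
  rw [e1]
  conv_rhs => rw [hm]
  rw [Finset.sum_range_add _ (i + 2), Finset.sum_range_add _ (i + 1), Finset.sum_range_succ _ (i + 1),
    Finset.sum_range_succ _ i, Finset.sum_range_succ _ i, edgeLbl_i h i c hi, edgeLbl_i1 h i c hi]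
  have s1 : ∑ x ∈ Finset.range i, (if edgeLbl (glueResult D i c) x = e then 1 else 0) =
      ∑ x ∈ Finset.range i, (if edgeLbl D x = e then 1 else 0) := by
    refine Finset.sum_congr rfl fun x hx => ?_
    rw [edgeLbl_lt h i c hi x (Finset.mem_range.1 hx)]
  have s2 : ∑ x ∈ Finset.range m, (if edgeLbl (glueResult D i c) (i + 2 + x) = e then 1 else 0) =
      ∑ x ∈ Finset.range m, (if edgeLbl D (i + 1 + x) = e then 1 else 0) := by
    refine Finset.sum_congr rfl fun x hx => ?_
    have hx := Finset.mem_range.1 hx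
    rw [show i + 2 + x = (i + 1 + x) + 1 by omega, edgeLbl_gt h i c hi (i+1+x) (by omega) (by omega)]
  rw [s1, s2]; ring

end Geometry

set_option linter.unusedSectionVars false

section Labels
variable {V : Type} [Fintype V] [DecidableEq V]

lemma conA_nil (e : Sym2 V) : conA ([] : List (V × V × V)) e = 0 := by
  unfold conA
  have : IsEmpty {i : Fin ([] : List (V × V × V)).length //
    e = s((([] : List (V × V × V)).get i).1, (([] : List (V × V × V)).get i).2.2) ∨
    e = s((([] : List (V × V × V)).get i).2.1, (([] : List (V × V × V)).get i).2.2)} :=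
    ⟨fun x => x.1.elim0⟩
  exact Nat.card_of_isEmpty

lemma conA_cons (st : V × V × V) (l : List (V × V × V)) (e : Sym2 V) :
    conA (st :: l) e = (if e = s(st.1, st.2.2) ∨ e = s(st.2.1, st.2.2) then 1 else 0) + conA l e := by
  unfold conA
  rw [Nat.card_eq_fintype_card, Nat.card_eq_fintype_card, Fintype.card_subtype, Fintype.card_subtype,
    Finset.card_filter, Finset.card_filter]
  exact Fin.sum_univ_succ (n := l.length) _

lemma mem_afterGraph (H : SimpleGraph V) (l : List (V × V × V)) (e : Sym2 V) :
    e ∈ (afterGraph H l).edgeSet ↔ e ∈ H.edgeSet ∨ ((∃ st ∈ l, e ∈ triEdges st) ∧ ¬ e.IsDiag) := by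
  unfold afterGraph
  rw [SimpleGraph.edgeSet_sup, SimpleGraph.edgeSet_fromEdgeSet]
  simp [Sym2.diagSet]

lemma valid_at {H : SimpleGraph V} {pre suf : List (V × V × V)} {st : V × V × V}
    (h : IsValidProcess H (pre ++ st :: suf)) :
    st.1 ≠ st.2.1 ∧ ¬ (afterGraph H pre).Adj st.1 st.2.1 ∧
    (afterGraph H pre).Adj st.1 st.2.2 ∧ (afterGraph H pre).Adj st.2.1 st.2.2 := by
  have := h pre.length (by simp)
  simpa using this

lemma afterGraph_snoc {H : SimpleGraph V} {pre : List (V × V × V)} {st : V × V × V}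
    (h1 : st.1 ≠ st.2.1) (h2 : (afterGraph H pre).Adj st.1 st.2.2)
    (h3 : (afterGraph H pre).Adj st.2.1 st.2.2) (e : Sym2 V) :
    e ∈ (afterGraph H (pre ++ [st])).edgeSet ↔ e ∈ (afterGraph H pre).edgeSet ∨ e = s(st.1, st.2.1) := by
  have h2' : s(st.1, st.2.2) ∈ (afterGraph H pre).edgeSet := h2
  have h3' : s(st.2.1, st.2.2) ∈ (afterGraph H pre).edgeSet := h3
  rw [mem_afterGraph] at h2' h3'
  rw [mem_afterGraph, mem_afterGraph]
  constructor
  · rintro (h | ⟨⟨t, ht, he⟩, hd⟩)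
    · exact Or.inl (Or.inl h)
    · rcases List.mem_append.1 ht with ht | ht
      · exact Or.inl (Or.inr ⟨⟨t, ht, he⟩, hd⟩)
      · rw [List.mem_singleton] at ht
        subst ht
        rcases he with he | he | he
        · exact Or.inr he
        · rw [he]; exact Or.inl h2'
        · rw [Set.mem_singleton_iff.1 he]; exact Or.inl h3'
  · rintro ((h | ⟨⟨t, ht, he⟩, hd⟩) | rfl)
    · exact Or.inl h
    · exact Or.inr ⟨⟨t, List.mem_append_left _ ht, he⟩, hd⟩
    · exact Or.inr ⟨⟨st, by simp, by simp [triEdges]⟩, by simpa using h1⟩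

open scoped Classical in
structure DL (H G K C : SimpleGraph V) (suf : List (V × V × V)) (D : DiagState V) : Prop where
  inj : Set.InjOn (Sym2.map D.label) D.marked
  mG : ∀ e ∈ D.marked, Sym2.map D.label e ∈ G.edgeSet
  eK : ∀ j < D.boundary.length, edgeLbl D j ∈ K.edgeSet
  cnt : ∀ e ∈ H.edgeSet, fib (edgeLbl D) D.boundary.length e =
    (if e ∈ C.edgeSet then 1 else 0) + conA suf e
  hm : ∀ e ∈ H.edgeSet, (∃ j < D.boundary.length, edgeLbl D j = e) →
    ∃ f ∈ D.marked, Sym2.map D.label f = e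
  ff : ∀ st ∈ suf, ∃ q ∈ D.faces, q.1 < D.nv ∧ q.2.1 < D.nv ∧ q.2.2 < D.nv ∧
    s(D.label q.1, D.label q.2.1) = s(st.1, st.2.1) ∧ D.label q.2.2 = st.2.2

lemma DL.glue {l : ℕ} {H G G1 K C : SimpleGraph V} {suf : List (V × V × V)} {D : DiagState V}
    (hD : DS l D) (h : DL H G1 K C suf D) (a b c : V) (i : ℕ) (hi : i < D.boundary.length)
    (hmk : s(Bd D i, Bd D (i + 1)) ∈ D.marked)
    (hs : s(D.label (Bd D i), D.label (Bd D (i + 1))) = s(a, b))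
    (hab : a ≠ b) (hnG : ¬ G.Adj a b) (hac : G.Adj a c) (hbc : G.Adj b c)
    (hG1 : ∀ e ∈ G1.edgeSet, e ∈ G.edgeSet ∨ e = s(a, b)) (hHG : H ≤ G) (hGK : G ≤ K) :
    DL H G K C ((a, b, c) :: suf) (glueResult D i c) := by
  have h0 : 0 < D.boundary.length := by omega
  have hlen := glue_length D i c hi
  have hmm := (glueResult_eq D i c hi).1
  have hff := (glueResult_eq D i c hi).2
  set x := Bd D i with hx
  set y := Bd D (i + 1) with hy
  have hxl : x < D.nv := hD.Bd_lt h0 _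
  have hyl : y < D.nv := hD.Bd_lt h0 _
  -- symmetric form of the hypotheses
  have key : D.label x ≠ D.label y ∧ ¬ G.Adj (D.label x) (D.label y) ∧ G.Adj (D.label x) c ∧
      G.Adj (D.label y) c ∧ (∀ e : Sym2 V, (e = s(a, c) ∨ e = s(b, c)) ↔
        (e = s(D.label x, c) ∨ e = s(D.label y, c))) := by
    rcases Sym2.eq_iff.1 hs with ⟨h1, h2⟩ | ⟨h1, h2⟩
    · rw [h1, h2]; exact ⟨hab, hnG, hac, hbc, fun e => Iff.rfl⟩
    · rw [h1, h2]; exact ⟨hab.symm, fun h => hnG h.symm, hbc, hac, fun e => or_comm⟩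
  obtain ⟨k1, k2, k3, k4, k5⟩ := key
  have hvl : ∀ e ∈ D.marked, ∀ z ∈ e, z < D.nv := by
    intro e he z hz
    obtain ⟨j, -, rfl⟩ := hD.mkd e he
    rcases Sym2.mem_iff.1 hz with rfl | rfl <;> exact hD.Bd_lt h0 _
  have hlab : ∀ e ∈ D.marked, Sym2.map (glueResult D i c).label e = Sym2.map D.label e := by
    intro e he
    refine Sym2.map_congr fun z hz => glue_label_old hD i c (hvl e he z hz)
  have lx : Sym2.map (glueResult D i c).label s(x, D.nv) = s(D.label x, c) := by
    rw [Sym2.map_mk, glue_label_old hD i c hxl, glue_label_new]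
  have ly : Sym2.map (glueResult D i c).label s(y, D.nv) = s(D.label y, c) := by
    rw [Sym2.map_mk, glue_label_old hD i c hyl, glue_label_new]
  have hxy : s(D.label x, c) ≠ s(D.label y, c) := by
    intro h; rcases Sym2.eq_iff.1 h with ⟨h, -⟩ | ⟨h, h'⟩
    · exact k1 h
    · exact k1 (h.trans h')
  have hxne : s(D.label x, c) ≠ s(D.label x, D.label y) := by
    intro h; apply k2; rw [← SimpleGraph.mem_edgeSet, ← h]; exact k3
  have hyne : s(D.label y, c) ≠ s(D.label x, D.label y) := by
    intro h; apply k2; rw [← SimpleGraph.mem_edgeSet, ← h]; exact k4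
  refine ⟨?_, ?_, ?_, ?_, ?_, ?_⟩
  · intro e he f hf hef
    rw [hmm] at he hf
    rcases he with ⟨he, -⟩ | ⟨rfl, he⟩ | ⟨rfl, he⟩ <;>
      rcases hf with ⟨hf, -⟩ | ⟨rfl, hf⟩ | ⟨rfl, hf⟩
    · rw [hlab e he, hlab f hf] at hef; exact h.inj he hf hef
    · rw [hlab e he, lx] at hef; exact absurd ⟨e, he, hef⟩ hf
    · rw [hlab e he, ly] at hef; exact absurd ⟨e, he, hef⟩ hf
    · rw [hlab f hf, lx] at hef; exact absurd ⟨f, hf, hef.symm⟩ he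
    · rfl
    · rw [lx, ly] at hef; exact absurd hef hxy
    · rw [hlab f hf, ly] at hef; exact absurd ⟨f, hf, hef.symm⟩ he
    · rw [lx, ly] at hef; exact absurd hef.symm hxy
    · rfl
  · intro e he
    rw [hmm] at he
    rcases he with ⟨he, hne⟩ | ⟨rfl, he⟩ | ⟨rfl, he⟩
    · rw [hlab e he]
      rcases hG1 _ (h.mG e he) with h1 | h1
      · exact h1
      · exact absurd (h.inj he hmk (by rw [h1, Sym2.map_mk, hs])) hne
    · rw [lx]; exact k3
    · rw [ly]; exact k4
  · intro j hj
    rw [hlen] at hj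
    rcases edgeLbl_cases hD i c hi j hj with ⟨k, hk, -, e⟩ | e | e
    · rw [e]; exact h.eK k hk
    · rw [e]; exact hGK k3
    · rw [e]; exact hGK k4
  · intro e he
    have h1 := fib_glue hD i c hi e
    have h2 := h.cnt e he
    rw [hlen, conA_cons]
    have h3 : edgeLbl D i ≠ e := by
      rintro rfl
      exact k2 (hHG he)
    simp only [k5]
    rw [if_neg h3] at h1
    simp only [← hx, ← hy, eq_comm (b := e)] at h1
    rw [add_zero] at h1
    rw [h1, h2]
    by_cases e1 : e = s(D.label x, c) <;> by_cases e2 : e = s(D.label y, c)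
    · exact absurd (e1.symm.trans e2) hxy
    · rw [if_pos e1, if_neg e2, if_pos (Or.inl e1)]; omega
    · rw [if_neg e1, if_pos e2, if_pos (Or.inr e2)]; omega
    · rw [if_neg e1, if_neg e2, if_neg (not_or.2 ⟨e1, e2⟩)]; omega
  · intro e he ⟨j, hj, hje⟩
    rw [hlen] at hj
    rw [hmm]
    have hne : e ≠ s(D.label x, D.label y) := by
      rintro rfl; exact k2 (hHG he)
    have fin : ∀ f ∈ D.marked, Sym2.map D.label f = e →
        ∃ f ∈ glueMarked D x y c, Sym2.map (glueResult D i c).label f = e := by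
      intro f hf hfe
      refine ⟨f, Or.inl ⟨hf, ?_⟩, by rw [hlab f hf, hfe]⟩
      rintro rfl
      exact hne hfe.symm
    rcases edgeLbl_cases hD i c hi j hj with ⟨k, hk, -, e1⟩ | e1 | e1
    · obtain ⟨f, hf, hfe⟩ := h.hm e he ⟨k, hk, by rw [← e1, hje]⟩
      exact fin f hf hfe
    · by_cases hex : ∃ f ∈ D.marked, Sym2.map D.label f = s(D.label x, c)
      · obtain ⟨f, hf, hfe⟩ := hex
        exact fin f hf (by rw [hfe, ← hje, e1])
      · exact ⟨s(x, D.nv), Or.inr (Or.inl ⟨rfl, hex⟩), by rw [lx, ← hje, e1]⟩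
    · by_cases hex : ∃ f ∈ D.marked, Sym2.map D.label f = s(D.label y, c)
      · obtain ⟨f, hf, hfe⟩ := hex
        exact fin f hf (by rw [hfe, ← hje, e1])
      · exact ⟨s(y, D.nv), Or.inr (Or.inr ⟨rfl, hex⟩), by rw [ly, ← hje, e1]⟩
  · have hnv : (glueResult D i c).nv = D.nv + 1 := rfl
    intro st hst
    rw [hff, hnv]
    rcases List.mem_cons.1 hst with rfl | hst
    · refine ⟨_, List.mem_cons_self, by simp only; omega, by simp only; omega, by simp, ?_, ?_⟩
      · simp only
        rw [glue_label_old hD i c hxl, glue_label_old hD i c hyl, hs]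
      · simp only
        rw [glue_label_new]
    · obtain ⟨q, hq, q1, q2, q3, q4, q5⟩ := h.ff st hst
      refine ⟨q, List.mem_cons_of_mem _ hq, by omega, by omega, by omega, ?_, ?_⟩
      · rw [glue_label_old hD i c q1, glue_label_old hD i c q2, q4]
      · rw [glue_label_old hD i c q3, q5]

lemma afterGraph_mono (H : SimpleGraph V) {l l' : List (V × V × V)} (h : l ⊆ l') :
    afterGraph H l ≤ afterGraph H l' := by
  rw [← SimpleGraph.edgeSet_subset_edgeSet]
  intro e he
  rw [mem_afterGraph] at he ⊢
  rcases he with he | ⟨⟨t, ht, he⟩, hd⟩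
  · exact Or.inl he
  · exact Or.inr ⟨⟨t, h ht, he⟩, hd⟩

lemma reach_inv {l : ℕ} {H C : SimpleGraph V} {D0 : DiagState V} (hD0 : DS l D0) :
    ∀ (suf pre : List (V × V × V)) (D : DiagState V),
    IsValidProcess H (pre ++ suf) → DiagReaches suf D0 D →
    DL H (afterGraph H (pre ++ suf)) (afterGraph H (pre ++ suf)) C [] D0 →
    DS l D ∧ DL H (afterGraph H pre) (afterGraph H (pre ++ suf)) C suf D ∧
      D.boundary.length = D0.boundary.length + suf.length := by
  intro suf
  induction suf with
  | nil =>
    intro pre D _ hr h0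
    cases hr
    rw [List.append_nil] at *
    exact ⟨hD0, h0, by simp⟩
  | cons st suf ih =>
    intro pre D hv hr h0
    obtain ⟨Dm, hr, hg⟩ := hr
    have eqn : pre ++ st :: suf = (pre ++ [st]) ++ suf := by simp
    obtain ⟨h1, h2, h3⟩ := ih (pre ++ [st]) Dm (by rw [← eqn]; exact hv) hr (by rw [← eqn]; exact h0)
    obtain ⟨i, hi, hmk, hs, rfl⟩ := hg
    obtain ⟨v1, v2, v3, v4⟩ := valid_at hv
    rw [Bd_getD hi] at hmk hs
    refine ⟨h1.glue i _ hi, ?_, ?_⟩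
    · rw [← eqn] at h2
      refine DL.glue h1 h2 st.1 st.2.1 st.2.2 i hi hmk hs v1 v2 v3 v4 ?_ ?_ ?_
      · intro e he
        exact (afterGraph_snoc v1 v3 v4 e).1 he
      · exact le_sup_left
      · exact afterGraph_mono H (by simp)
    · rw [glue_length _ _ _ hi, h3]; simp; omega
end Labels

set_option linter.unusedSectionVars false

section Init
variable {V : Type} [Fintype V] [DecidableEq V]

lemma init_Bd (x : V) (cyc : List V) (hc : 0 < cyc.length) (j : ℕ) :
    Bd (initState x cyc) j = j % cyc.length := by
  have := Nat.mod_lt j hc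
  simp [Bd, initState, this]

lemma init_edgeLbl {G : SimpleGraph V} {x : V} (wk : G.Walk x x) (j : ℕ) (hj : j < wk.edges.length) :
    edgeLbl (initState x wk.support.dropLast) j = wk.edges[j] := by
  have hl : wk.support.dropLast.length = wk.length := by simp
  have hj' : j < wk.length := by simpa using hj
  have key : ∀ k (hk : k ≤ wk.length), (initState x wk.support.dropLast).label
      (Bd (initState x wk.support.dropLast) k) = wk.support[k]'(by simp; omega) := by
    intro k hk
    rw [init_Bd _ _ (by omega), hl]
    rcases hk.lt_or_eq with hk | rfl
    · rw [Nat.mod_eq_of_lt hk]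
      simp only [initState]
      rw [List.getD_eq_getElem _ _ (by omega)]
      simp
    · rw [Nat.mod_self]
      simp only [initState]
      rw [List.getD_eq_getElem _ _ (by omega)]
      simp
  unfold edgeLbl
  rw [key j hj'.le, key (j+1) hj', SimpleGraph.Walk.getElem_edges_eq_edge_getElem_darts]
  simp [SimpleGraph.Dart.edge, Sym2.mk, SimpleGraph.Walk.fst_darts_getElem, SimpleGraph.Walk.snd_darts_getElem]

lemma init_DS (x : V) (cyc : List V) (hc : 0 < cyc.length) : DS cyc.length (initState x cyc) := by
  refine ⟨?_, ?_, ?_, ?_⟩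
  · exact List.nodup_range
  · intro i; simp [initState]
  · intro e he
    simp only [initState, cycEdges, Set.mem_ofPred_eq, List.mem_map] at he
    obtain ⟨⟨a, b⟩, hq, rfl⟩ := he
    obtain ⟨j, hj, hq⟩ := List.getElem_of_mem hq
    have hj2 : j < cyc.length := by simpa using hj
    refine ⟨j, by simpa [initState] using hj2, ?_⟩
    rw [init_Bd _ _ hc, init_Bd _ _ hc, Nat.mod_eq_of_lt hj2]
    rw [List.getElem_zip, List.getElem_rotate] at hq
    simp at hq
    rw [← hq.1, ← hq.2]
  · refine ⟨List.replicate cyc.length BT.leaf, by simp, by simp [flv_init, initState], ?_⟩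
    rw [forest_init]
    simp [faceSets, initState]

lemma init_marked {x : V} {cyc : List V} (hc : 0 < cyc.length) {f : Sym2 ℕ} 
    (hf : f ∈ (initState x cyc).marked) :
    ∃ j < cyc.length, f = s(Bd (initState x cyc) j, Bd (initState x cyc) (j+1)) := by
  obtain ⟨j, hj, h⟩ := (init_DS x cyc hc).mkd f hf
  exact ⟨j, by simpa [initState] using hj, h⟩

lemma marked_init {x : V} {cyc : List V} (hc : 0 < cyc.length) {j : ℕ} (hj : j < cyc.length) :
    s(Bd (initState x cyc) j, Bd (initState x cyc) (j+1)) ∈ (initState x cyc).marked := by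
  rw [init_Bd _ _ hc, init_Bd _ _ hc, Nat.mod_eq_of_lt hj]
  simp only [initState, cycEdges, Set.mem_ofPred_eq, List.mem_map]
  refine ⟨(j, (j+1) % cyc.length), ?_, rfl⟩
  have : j < ((List.range cyc.length).zip ((List.range cyc.length).rotate 1)).length := by simpa using hj
  convert List.getElem_mem this using 1
  rw [List.getElem_zip, List.getElem_rotate]
  simp

lemma init_DL {H K : SimpleGraph V} (hHK : H ≤ K) {x : V} (wk : K.Walk x x) (hc : wk.IsCycle) :
    DL H K K (walkEdgeGraph wk) [] (initState x wk.support.dropLast) := by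
  have hl : wk.support.dropLast.length = wk.length := by simp
  have hl2 : (initState x wk.support.dropLast).boundary.length = wk.length := by simp [initState]
  have hl3 : wk.edges.length = wk.length := by simp
  have h0 : 0 < wk.length := by have := hc.three_le_length; omega
  have hnd : wk.edges.Nodup := hc.isTrail.edges_nodup
  have mk : ∀ f ∈ (initState x wk.support.dropLast).marked, ∃ j, ∃ hj : j < wk.edges.length,
      f = s(Bd (initState x wk.support.dropLast) j, Bd (initState x wk.support.dropLast) (j+1)) ∧
      Sym2.map (initState x wk.support.dropLast).label f = wk.edges[j] := by
    intro f hf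
    obtain ⟨j, hj, rfl⟩ := init_marked (by omega) hf
    refine ⟨j, by omega, rfl, ?_⟩
    rw [← init_edgeLbl wk j (by omega)]; rfl
  refine ⟨?_, ?_, ?_, ?_, ?_, ?_⟩
  · intro e he f hf hef
    obtain ⟨j, hj, rfl, h1⟩ := mk e he
    obtain ⟨k, hk, rfl, h2⟩ := mk f hf
    rw [h1, h2] at hef
    rw [hnd.getElem_inj_iff] at hef
    subst hef; rfl
  · intro e he
    obtain ⟨j, hj, rfl, h1⟩ := mk e he
    rw [h1]; exact wk.edges_subset_edgeSet (List.getElem_mem _)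
  · intro j hj
    rw [init_edgeLbl wk j (by omega)]
    exact wk.edges_subset_edgeSet (List.getElem_mem _)
  · intro e he
    rw [hl2, conA_nil, add_zero]
    have hCe : e ∈ (walkEdgeGraph wk).edgeSet ↔ e ∈ wk.edges := by
      unfold walkEdgeGraph
      rw [SimpleGraph.edgeSet_fromEdgeSet]
      constructor
      · exact fun h => h.1
      · exact fun h => ⟨h, fun hd => (H.not_isDiag_of_mem_edgeSet he) hd⟩
    unfold fib
    split_ifs with h
    · rw [hCe] at h
      obtain ⟨k, hk, rfl⟩ := List.getElem_of_mem h
      rw [Finset.card_eq_one]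
      refine ⟨k, ?_⟩
      ext j
      simp only [Finset.mem_filter, Finset.mem_range, Finset.mem_singleton]
      constructor
      · rintro ⟨hj, he⟩
        rw [init_edgeLbl wk j (by omega), hnd.getElem_inj_iff] at he
        exact he
      · rintro rfl
        exact ⟨by omega, init_edgeLbl wk j hk⟩
    · rw [hCe] at h
      rw [Finset.card_eq_zero, Finset.filter_eq_empty_iff]
      intro j hj hje
      apply h
      rw [← hje, init_edgeLbl wk j (by rw [hl3]; exact Finset.mem_range.1 hj)]
      exact List.getElem_mem _
  · intro e he ⟨j, hj, hje⟩
    exact ⟨_, marked_init (by omega) (by omega), hje⟩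
  · simp
end Init

set_option linter.unusedSectionVars false

section Final
variable {V : Type} [Fintype V] [DecidableEq V]

lemma sum_conA (l : List (V × V × V)) (F : Finset (Sym2 V))
    (h : ∀ st ∈ l, st.1 ≠ st.2.1 ∧ s(st.1, st.2.2) ∈ F ∧ s(st.2.1, st.2.2) ∈ F) :
    ∑ e ∈ F, conA l e = 2 * l.length := by
  induction l with
  | nil => simp [conA_nil]
  | cons st l ih =>
    simp only [conA_cons, Finset.sum_add_distrib]
    rw [ih fun t ht => h t (List.mem_cons_of_mem _ ht)]
    obtain ⟨h1, h2, h3⟩ := h st List.mem_cons_self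
    have hne : s(st.1, st.2.2) ≠ s(st.2.1, st.2.2) := by
      intro h; rcases Sym2.eq_iff.1 h with ⟨h, -⟩ | ⟨h, h'⟩
      · exact h1 h
      · exact h1 (h.trans h')
    rw [← Finset.card_filter]
    have : F.filter (fun e => e = s(st.1, st.2.2) ∨ e = s(st.2.1, st.2.2)) =
        {s(st.1, st.2.2), s(st.2.1, st.2.2)} := by
      ext e
      simp only [Finset.mem_filter, Finset.mem_insert, Finset.mem_singleton]
      constructor
      · exact fun h => h.2
      · rintro (rfl | rfl)
        · exact ⟨h2, Or.inl rfl⟩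
        · exact ⟨h3, Or.inr rfl⟩
    rw [this, Finset.card_pair hne]
    simp; omega

lemma conA_pos {l : List (V × V × V)} {e : Sym2 V} (h : 0 < conA l e) :
    ∃ st ∈ l, e ∈ triEdges st := by
  induction l with
  | nil => simp [conA_nil] at h
  | cons st l ih =>
    rw [conA_cons] at h
    split_ifs at h with h1
    · refine ⟨st, List.mem_cons_self, ?_⟩
      rcases h1 with h1 | h1 <;> simp [triEdges, h1]
    · obtain ⟨t, ht, hte⟩ := ih (by omega)
      exact ⟨t, List.mem_cons_of_mem _ ht, hte⟩

lemma afterGraph_nil (H : SimpleGraph V) : afterGraph H [] = H := by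
  rw [← SimpleGraph.edgeSet_inj]
  ext e
  simp [mem_afterGraph]

lemma card_after (H : SimpleGraph V) : ∀ (suf pre : List (V × V × V)), IsValidProcess H (pre ++ suf) →
    (afterGraph H (pre ++ suf)).edgeSet.ncard = (afterGraph H pre).edgeSet.ncard + suf.length := by
  intro suf
  induction suf with
  | nil => intro pre _; simp
  | cons st suf ih =>
    intro pre hv
    have eqn : pre ++ st :: suf = (pre ++ [st]) ++ suf := by simp
    obtain ⟨v1, v2, v3, v4⟩ := valid_at hv
    have hset : (afterGraph H (pre ++ [st])).edgeSet =
        insert s(st.1, st.2.1) (afterGraph H pre).edgeSet := by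
      ext e
      rw [afterGraph_snoc v1 v3 v4, Set.mem_insert_iff, or_comm]
    rw [eqn, ih _ (by rw [← eqn]; exact hv), hset,
      Set.ncard_insert_of_notMem (show s(st.1, st.2.1) ∉ _ from v2) (Set.toFinite _)]
    simp; omega

lemma reach_after (H : SimpleGraph V) : ∀ (suf pre : List (V × V × V)), IsValidProcess H (pre ++ suf) →
    (∀ a b, (afterGraph H pre).Adj a b → H.Reachable a b) →
    (∀ a b, (afterGraph H (pre ++ suf)).Adj a b → H.Reachable a b) := by
  intro suf
  induction suf with
  | nil => intro pre _ h; simpa using h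
  | cons st suf ih =>
    intro pre hv h
    have eqn : pre ++ st :: suf = (pre ++ [st]) ++ suf := by simp
    obtain ⟨v1, v2, v3, v4⟩ := valid_at hv
    rw [eqn]
    refine ih _ (by rw [← eqn]; exact hv) ?_
    intro a b hab
    rcases (afterGraph_snoc v1 v3 v4 s(a, b)).1 hab with h1 | h1
    · exact h a b h1
    · have hr := (h _ _ v3).trans (h _ _ v4).symm
      rcases Sym2.eq_iff.1 h1 with ⟨rfl, rfl⟩ | ⟨rfl, rfl⟩
      · exact hr
      · exact hr.symm

lemma walkEdge_mem {K : SimpleGraph V} {x : V} (wk : K.Walk x x) (e : Sym2 V) :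
    e ∈ (walkEdgeGraph wk).edgeSet ↔ e ∈ wk.edges := by
  unfold walkEdgeGraph
  rw [SimpleGraph.edgeSet_fromEdgeSet]
  constructor
  · exact fun h => h.1
  · exact fun h => ⟨h, fun hd => (K.not_isDiag_of_mem_edgeSet (wk.edges_subset_edgeSet h)) hd⟩

lemma valid_mem {H : SimpleGraph V} {l : List (V × V × V)} (hv : IsValidProcess H l) {st : V × V × V}
    (hst : st ∈ l) : st.1 ≠ st.2.1 ∧ (afterGraph H l).Adj st.1 st.2.2 ∧
      (afterGraph H l).Adj st.2.1 st.2.2 := by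
  obtain ⟨i, hi, rfl⟩ := List.getElem_of_mem hst
  obtain ⟨h1, -, h2, h3⟩ := hv i hi
  have hm := afterGraph_mono H (List.take_subset i l)
  exact ⟨h1, hm h2, hm h3⟩

lemma exc_identity {H : SimpleGraph V} {l : List (V × V × V)} (hv : IsValidProcess H l) {x : V}
    (wk : (afterGraph H l).Walk x x) (hc : wk.IsCycle) :
    excSum H (walkEdgeGraph wk) l = (l.length : ℤ) - 2 * edgeCard H + wk.length := by
  classical
  unfold excSum
  rw [finsum_mem_eq_toFinset_sum]
  have hKc : ((afterGraph H l).edgeSet.toFinset.card : ℤ) = edgeCard H + l.length := by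
    have := card_after H l [] hv
    rw [afterGraph_nil, List.nil_append] at this
    rw [← Set.ncard_eq_toFinset_card', this]
    rw [edgeCard, Nat.card_coe_set_eq]; push_cast; rfl
  have hHc : (((afterGraph H l).edgeSet.toFinset.filter (fun e => e ∈ H.edgeSet)).card : ℤ) = edgeCard H := by
    have : (afterGraph H l).edgeSet.toFinset.filter (fun e => e ∈ H.edgeSet) = H.edgeSet.toFinset := by
      ext e
      simp only [Finset.mem_filter, Set.mem_toFinset]
      exact ⟨fun h => h.2, fun h => ⟨(mem_afterGraph H l e).2 (Or.inl h), h⟩⟩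
    rw [this, edgeCard, Nat.card_eq_card_toFinset]
  have hCc : (((afterGraph H l).edgeSet.toFinset.filter (fun e => e ∈ (walkEdgeGraph wk).edgeSet)).card : ℤ)
      = wk.length := by
    have : (afterGraph H l).edgeSet.toFinset.filter (fun e => e ∈ (walkEdgeGraph wk).edgeSet) = wk.edges.toFinset := by
      ext e
      simp only [Finset.mem_filter, Set.mem_toFinset, List.mem_toFinset, walkEdge_mem]
      exact ⟨fun h => h.2, fun h => ⟨wk.edges_subset_edgeSet h, h⟩⟩
    rw [this, List.toFinset_card_of_nodup hc.isTrail.edges_nodup]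
    simp
  have hcon := sum_conA l (afterGraph H l).edgeSet.toFinset (by
    intro st hst
    obtain ⟨h1, h2, h3⟩ := valid_mem hv hst
    exact ⟨h1, by simpa using h2, by simpa using h3⟩)
  have hterm : ∀ e, excA H (walkEdgeGraph wk) l e = (conA l e : ℤ) - 1 +
      (if e ∈ (walkEdgeGraph wk).edgeSet then 1 else 0) - (if e ∈ H.edgeSet then 1 else 0) := by
    intro e
    unfold excA
    split_ifs <;> ring
  simp only [hterm, Finset.sum_add_distrib, Finset.sum_sub_distrib]
  rw [← Nat.cast_sum, hcon]
  rw [Finset.sum_boole, Finset.sum_boole, hHc, hCc, Finset.sum_const, nsmul_eq_mul, hKc]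
  push_cast; ring

lemma mem_support_of_reach {H : SimpleGraph V} {a b : V} (h : H.Reachable a b) (hab : a ≠ b) :
    a ∈ H.support := by
  obtain ⟨p⟩ := h
  cases p with
  | nil => exact absurd rfl hab
  | cons h p => exact ⟨_, h⟩

lemma conn_bound {H : SimpleGraph V} (hne : H.support.Nonempty)
    (h : ∀ a ∈ H.support, ∀ b ∈ H.support, H.Reachable a b) :
    supportCard H ≤ edgeCard H + 1 := by
  classical
  have hconn : (H.induce H.support).Connected := by
    have : Nonempty H.support := hne.to_subtype
    refine ⟨fun a b => ?_⟩
    obtain ⟨p⟩ := h a a.2 b b.2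
    have hp : ∀ z ∈ p.support, z ∈ H.support := by
      intro z hz
      by_cases hza : z = a
      · rw [hza]; exact a.2
      · exact mem_support_of_reach ⟨(p.takeUntil z hz).reverse⟩ hza
    exact ⟨p.induce H.support hp⟩
  have h1 := hconn.card_vert_le_card_edgeSet_add_one
  have h2 : Nat.card (H.induce H.support).edgeSet ≤ Nat.card H.edgeSet :=
    Nat.card_le_card_of_injective _
      (SimpleGraph.Embedding.induce (G := H) H.support).mapEdgeSet.injective
  unfold supportCard edgeCard
  omega

lemma DS.Bd_inj {l : ℕ} {D : DiagState V} (h : DS l D) {j k : ℕ} (h0 : 0 < D.boundary.length)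
    (hjk : Bd D j = Bd D k) : j % D.boundary.length = k % D.boundary.length := by
  have h1 := Nat.mod_lt j h0
  have h2 := Nat.mod_lt k h0
  simp only [Bd, List.getD_eq_getElem _ _ h1, List.getD_eq_getElem _ _ h2] at hjk
  exact (h.nodup.getElem_inj_iff).1 hjk

lemma DS.edge_inj {l : ℕ} {D : DiagState V} (h : DS l D) {j k : ℕ} (h3 : 3 ≤ D.boundary.length)
    (hj : j < D.boundary.length) (hk : k < D.boundary.length)
    (hjk : s(Bd D j, Bd D (j + 1)) = s(Bd D k, Bd D (k + 1))) : j = k := by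
  rcases Sym2.eq_iff.1 hjk with ⟨e, -⟩ | ⟨e1, e2⟩
  · have := h.Bd_inj (by omega) e
    rwa [Nat.mod_eq_of_lt hj, Nat.mod_eq_of_lt hk] at this
  · have e1 := h.Bd_inj (by omega) e1
    have e2 := h.Bd_inj (by omega) e2
    rw [Nat.mod_eq_of_lt hj] at e1
    rw [Nat.mod_eq_of_lt hk] at e2
    exfalso
    rcases Nat.lt_or_ge (k+1) D.boundary.length with hh | hh
    · rw [Nat.mod_eq_of_lt hh] at e1
      rcases Nat.lt_or_ge (j+1) D.boundary.length with hh2 | hh2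
      · rw [Nat.mod_eq_of_lt hh2] at e2; omega
      · have : j + 1 = D.boundary.length := by omega
        rw [this, Nat.mod_self] at e2; omega
    · have : k + 1 = D.boundary.length := by omega
      rw [this, Nat.mod_self] at e1
      rw [e1, Nat.mod_eq_of_lt (by omega)] at e2; omega

open scoped Classical in
/-- Positions of the marked edges. -/
noncomputable def Mk (D : DiagState V) : Finset ℕ :=
  (Finset.range D.boundary.length).filter (fun j => s(Bd D j, Bd D (j + 1)) ∈ D.marked)

lemma Pvw_facts {n ℓ v w : ℕ} {D : DiagState (Fin n)} (hD : D ∈ Pvw n ℓ v w) :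
    DS ℓ D ∧ 3 ≤ D.boundary.length ∧ D.boundary.length + 2 = 2 * v + w ∧
    (D.boundary.map D.label).toFinset.card = v ∧
    GoodM (edgeLbl D) D.boundary.length v (Mk D) ∧
    ∃ F : Finset (Sym2 (Fin n)), 3 * v + w ≤ F.card + ℓ + 3 ∧
      ∀ e ∈ F, ¬ e.IsDiag ∧ ∃ t ∈ faceSets D, ∃ x ∈ t, ∃ y ∈ t, e = s(D.label x, D.label y) := by
  classical
  obtain ⟨H, steps, x, wk, hc, hlen, ⟨hval, hCK, hnice⟩, hsup, hw, hr⟩ := hD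
  have hl : wk.support.dropLast.length = ℓ := by simp [hlen]
  have h3 : 3 ≤ ℓ := hlen ▸ hc.three_le_length
  have hDS0 : DS ℓ (initState x wk.support.dropLast) := by
    have := init_DS x wk.support.dropLast (by omega)
    rwa [hl] at this
  have hHK : H ≤ afterGraph H steps := le_sup_left
  obtain ⟨hS, hL, hB⟩ := reach_inv (C := walkEdgeGraph wk) hDS0 steps [] D hval hr (init_DL hHK wk hc)
  rw [afterGraph_nil, List.nil_append] at hL
  have hB0 : (initState x wk.support.dropLast).boundary.length = ℓ := by simp [initState, hlen]
  rw [hB0] at hB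
  have hL3 : 3 ≤ D.boundary.length := by omega
  have h0 : 0 < D.boundary.length := by omega
  have hexc := exc_identity hval wk hc
  have hfib : ∀ e ∈ H.edgeSet, 2 ≤ fib (edgeLbl D) D.boundary.length e := by
    intro e he
    rw [hL.cnt e he]
    have := hnice e (SimpleGraph.edgeSet_mono hHK he)
    unfold excA at this
    rw [if_pos he, if_pos he] at this
    split_ifs at this ⊢ <;> omega
  have hcpos : ∀ e ∈ H.edgeSet, 0 < conA steps e := by
    intro e he
    have := hnice e (SimpleGraph.edgeSet_mono hHK he)
    unfold excA at this
    rw [if_pos he, if_pos he] at this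
    split_ifs at this <;> omega
  have hocc : ∀ e ∈ H.edgeSet, ∃ j < D.boundary.length, edgeLbl D j = e := by
    intro e he
    have := hfib e he
    unfold fib at this
    obtain ⟨j, hj⟩ := Finset.card_pos.1 (lt_of_lt_of_le two_pos this)
    rw [Finset.mem_filter, Finset.mem_range] at hj
    exact ⟨j, hj⟩
  have hadjB : ∀ j, (afterGraph H steps).Adj (D.label (Bd D j)) (D.label (Bd D (j+1))) := by
    intro j
    have h1 := hL.eK (j % D.boundary.length) (Nat.mod_lt _ h0)
    have e1 : Bd D (j % D.boundary.length) = Bd D j := by simp [Bd]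
    have e2 : Bd D (j % D.boundary.length + 1) = Bd D (j + 1) := by simp [Bd]
    unfold edgeLbl at h1
    rw [e1, e2] at h1
    exact h1
  have hreach := reach_after H steps [] hval (by rw [afterGraph_nil]; exact fun a b h => h.reachable)
  rw [List.nil_append] at hreach
  have hr0 : ∀ j, H.Reachable (D.label (Bd D 0)) (D.label (Bd D j)) := by
    intro j
    induction j with
    | zero => exact SimpleGraph.Reachable.refl _
    | succ j ih => exact ih.trans (hreach _ _ (hadjB j))
  have hsupp : ∀ u, u ∈ H.support ↔ ∃ j < D.boundary.length, u = D.label (Bd D j) := by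
    intro u
    constructor
    · rintro ⟨u', hu⟩
      obtain ⟨j, hj, hje⟩ := hocc s(u, u') hu
      unfold edgeLbl at hje
      rcases Sym2.eq_iff.1 hje with ⟨e, -⟩ | ⟨-, e⟩
      · exact ⟨j, hj, e.symm⟩
      · refine ⟨(j+1) % D.boundary.length, Nat.mod_lt _ h0, ?_⟩
        rw [← e]; simp [Bd]
    · rintro ⟨j, hj, rfl⟩
      exact mem_support_of_reach (hreach _ _ (hadjB j)) (hadjB j).ne
  have hlabset : ((D.boundary.map D.label).toFinset : Set (Fin n)) = H.support := by
    ext u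
    rw [hsupp]
    simp only [List.coe_toFinset, List.mem_map, Set.mem_ofPred_eq]
    constructor
    · rintro ⟨b, hb, rfl⟩
      obtain ⟨j, hj, rfl⟩ := List.getElem_of_mem hb
      exact ⟨j, hj, by rw [Bd_eq hj]⟩
    · rintro ⟨j, hj, rfl⟩
      exact ⟨_, Bd_mem h0 j, rfl⟩
  have hve : v ≤ edgeCard H + 1 := by
    rw [← hsup]
    refine conn_bound ⟨D.label (Bd D 0), (hsupp _).2 ⟨0, h0, rfl⟩⟩ ?_
    intro a ha b hb
    obtain ⟨j, -, rfl⟩ := (hsupp a).1 ha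
    obtain ⟨k, -, rfl⟩ := (hsupp b).1 hb
    exact (hr0 j).symm.trans (hr0 k)
  have hLeq : D.boundary.length + 2 = 2 * v + w := by
    unfold complexity at hw
    rw [hexc, hsup, hlen] at hw
    omega
  refine ⟨hS, hL3, hLeq, ?_, ?_, ?_⟩
  · rw [← hsup, supportCard, Nat.card_coe_set_eq, ← hlabset, Set.ncard_coe_finset]
  · refine ⟨Finset.filter_subset _ _, ?_, ?_, ?_⟩
    · intro j hj k hk hjk
      simp only [Mk, Finset.coe_filter, Finset.mem_range, Set.mem_ofPred_eq] at hj hk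
      exact hS.edge_inj hL3 hj.1 hk.1 (hL.inj hj.2 hk.2 hjk)
    · intro j hj
      simp only [Mk, Finset.mem_filter, Finset.mem_range] at hj
      exact hfib _ (hL.mG _ hj.2)
    · have : H.edgeSet.toFinset ⊆ (Mk D).image (edgeLbl D) := by
        intro e he
        rw [Set.mem_toFinset] at he
        obtain ⟨f, hf, rfl⟩ := hL.hm e he (hocc e he)
        obtain ⟨j, hj, rfl⟩ := hS.mkd f hf
        rw [Finset.mem_image]
        refine ⟨j, ?_, rfl⟩
        simp only [Mk, Finset.mem_filter, Finset.mem_range]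
        exact ⟨hj, hf⟩
      have h1 := (Finset.card_le_card this).trans Finset.card_image_le
      have h2 : H.edgeSet.toFinset.card = edgeCard H := by rw [edgeCard, Nat.card_eq_card_toFinset]
      omega
  · refine ⟨(afterGraph H steps).edgeSet.toFinset, ?_, ?_⟩
    · have := card_after H steps [] hval
      rw [afterGraph_nil, List.nil_append] at this
      rw [← Set.ncard_eq_toFinset_card', this]
      have h2 : H.edgeSet.ncard = edgeCard H := by rw [edgeCard, Nat.card_coe_set_eq]
      omega
    · intro e he
      rw [Set.mem_toFinset] at he
      refine ⟨SimpleGraph.not_isDiag_of_mem_edgeSet _ he, ?_⟩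
      have : ∃ st ∈ steps, e ∈ triEdges st := by
        rcases (mem_afterGraph _ _ _).1 he with h | h
        · exact conA_pos (hcpos e h)
        · exact h.1
      obtain ⟨st, hst, hest⟩ := this
      obtain ⟨q, hq, -, -, -, q4, q5⟩ := hL.ff st hst
      refine ⟨{q.1, q.2.1, q.2.2}, ⟨q, hq, rfl⟩, ?_⟩
      rcases hest with h | h | h
      · exact ⟨q.1, by simp, q.2.1, by simp, by rw [q4, h]⟩
      · rcases Sym2.eq_iff.1 q4 with ⟨a1, a2⟩ | ⟨a1, a2⟩
        · exact ⟨q.1, by simp, q.2.2, by simp, by rw [h, a1, q5]⟩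
        · exact ⟨q.2.1, by simp, q.2.2, by simp, by rw [h, a2, q5]⟩
      · rw [Set.mem_singleton_iff] at h
        rcases Sym2.eq_iff.1 q4 with ⟨a1, a2⟩ | ⟨a1, a2⟩
        · exact ⟨q.2.1, by simp, q.2.2, by simp, by rw [h, a2, q5]⟩
        · exact ⟨q.1, by simp, q.2.2, by simp, by rw [h, a1, q5]⟩
end Final

set_option linter.unusedSectionVars false

section Codes

/-- Label at cyclic position `j`. -/
def PL {n : ℕ} (x : Fin n) (lab : List (Fin n)) (j : ℕ) : Fin n := lab.getD (j % lab.length) x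

abbrev Code (n : ℕ) := List BT × (Fin n × List (Fin n) × Finset ℕ)

structure KRel {n : ℕ} (l : ℕ) (κ : Code n) (D : DiagState (Fin n)) : Prop where
  ds : DS l D
  pos : 0 < D.boundary.length
  fs : faceSets D = FS (Bd D) (fidx κ.1 0)
  lab : D.boundary.map D.label = κ.2.1 :: κ.2.2.1
  mks : κ.2.2.2 = Mk D

lemma KRel.label {n l : ℕ} {κ : Code n} {D : DiagState (Fin n)} (h : KRel l κ D) (j : ℕ) :
    D.label (Bd D j) = PL κ.2.1 (κ.2.1 :: κ.2.2.1) j := by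
  have hj := Nat.mod_lt j h.pos
  unfold PL
  rw [← h.lab]
  simp only [Bd, List.length_map]
  rw [List.getD_eq_getElem _ _ hj, List.getD_eq_getElem _ _ (by simpa using hj)]
  simp

lemma DS.nv_eq {V : Type} {l : ℕ} {D : DiagState V} (h : DS l D) : D.nv = D.boundary.length := by
  have : D.boundary.toFinset = Finset.range D.nv := by
    ext i; simp [h.mem]
  rw [← List.toFinset_card_of_nodup h.nodup, this, Finset.card_range]

lemma KRel.iso {n l : ℕ} {κ : Code n} {D₁ D₂ : DiagState (Fin n)} (h₁ : KRel l κ D₁) (h₂ : KRel l κ D₂) :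
    DiagIso D₁ D₂ := by
  have hl : D₁.boundary.length = D₂.boundary.length := by
    have e1 := congrArg List.length h₁.lab
    have e2 := congrArg List.length h₂.lab
    rw [List.length_map] at e1 e2
    rw [e1, e2]
  set f : ℕ → ℕ := fun i => Bd D₂ (D₁.boundary.idxOf i) with hf
  have fB : ∀ j, f (Bd D₁ j) = Bd D₂ j := by
    intro j
    have hj := Nat.mod_lt j h₁.pos
    simp only [hf]
    have : D₁.boundary.idxOf (Bd D₁ j) = j % D₁.boundary.length := by
      simp only [Bd, List.getD_eq_getElem _ _ hj]
      exact h₁.ds.nodup.idxOf_getElem _ _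
    rw [this, hl]
    simp [Bd]
  have ex : ∀ i < D₁.nv, ∃ j < D₁.boundary.length, i = Bd D₁ j := by
    intro i hi
    obtain ⟨j, hj, rfl⟩ := List.getElem_of_mem ((h₁.ds.mem i).2 hi)
    exact ⟨j, hj, (Bd_eq hj).symm⟩
  refine ⟨f, ?_, ?_, ?_, ?_, ?_, ?_, ?_⟩
  · rw [h₁.ds.nv_eq, h₂.ds.nv_eq, hl]
  · intro i hi k hk hik
    obtain ⟨a, ha, rfl⟩ := ex i hi
    obtain ⟨b, hb, rfl⟩ := ex k hk
    rw [fB, fB] at hik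
    have := h₂.ds.Bd_inj h₂.pos hik
    rw [← hl, Nat.mod_eq_of_lt ha, Nat.mod_eq_of_lt hb] at this
    rw [this]
  · intro i hi
    rw [h₁.ds.nv_eq, hl, ← h₂.ds.nv_eq]
    exact h₂.ds.Bd_lt h₂.pos _
  · intro i hi
    obtain ⟨a, ha, rfl⟩ := ex i hi
    rw [fB, h₁.label, h₂.label]
  · have : D₁.boundary.map f = D₂.boundary := by
      refine List.ext_getElem (by simpa using hl) ?_
      intro j hj1 hj2
      rw [List.getElem_map, ← Bd_eq hj2, ← fB, Bd_eq]
    rw [this]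
  · have hM : Mk D₁ = Mk D₂ := h₁.mks.symm.trans h₂.mks
    have tr : ∀ j < D₁.boundary.length, s(Bd D₁ j, Bd D₁ (j+1)) ∈ D₁.marked ↔
        s(Bd D₂ j, Bd D₂ (j+1)) ∈ D₂.marked := by
      intro j hj
      have := congrArg (j ∈ ·) hM
      simp only [Mk, Finset.mem_filter, Finset.mem_range, ← hl, hj, true_and] at this
      exact iff_of_eq this
    ext e
    constructor
    · intro he
      obtain ⟨j, hj, rfl⟩ := h₂.ds.mkd e he
      exact ⟨_, (tr j (hl ▸ hj)).2 he, by rw [Sym2.map_mk, fB, fB]⟩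
    · rintro ⟨e, he, rfl⟩
      obtain ⟨j, hj, rfl⟩ := h₁.ds.mkd e he
      rw [Sym2.map_mk, fB, fB]
      exact (tr j hj).1 he
  · rw [h₁.fs, h₂.fs]
    ext t
    constructor
    · rintro ⟨q, hq, rfl⟩
      exact ⟨_, ⟨q, hq, rfl⟩, by simp [Finset.image_insert, fB]⟩
    · rintro ⟨_, ⟨q, hq, rfl⟩, rfl⟩
      exact ⟨q, hq, by simp [Finset.image_insert, fB]⟩

open scoped Classical in
/-- The label edges forced by a code. -/
noncomputable def EK {n : ℕ} (κ : Code n) : Finset (Sym2 (Fin n)) :=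
  Finset.univ.filter (fun e => ¬ e.IsDiag ∧ ∃ q ∈ fidx κ.1 0,
    ∃ a ∈ ({q.1, q.2.1, q.2.2} : Finset ℕ), ∃ b ∈ ({q.1, q.2.1, q.2.2} : Finset ℕ),
      e = s(PL κ.2.1 (κ.2.1 :: κ.2.2.1) a, PL κ.2.1 (κ.2.1 :: κ.2.2.1) b))

lemma KRel.EK_faces {n l : ℕ} {κ : Code n} {D : DiagState (Fin n)} (h : KRel l κ D)
    {G : SimpleGraph (Fin n)} (hG : FacesInGraph D G) : ∀ e ∈ EK κ, e ∈ G.edgeSet := by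
  intro e he
  simp only [EK, Finset.mem_filter, Finset.mem_univ, true_and] at he
  obtain ⟨hd, q, hq, a, ha, b, hb, rfl⟩ := he
  rw [← h.label, ← h.label] at hd ⊢
  have ht : ({Bd D q.1, Bd D q.2.1, Bd D q.2.2} : Finset ℕ) ∈ faceSets D := by
    rw [h.fs]; exact ⟨q, hq, rfl⟩
  obtain ⟨r, hr, hre⟩ := ht
  have hin : ∀ a ∈ ({q.1, q.2.1, q.2.2} : Finset ℕ), Bd D a ∈ ({r.1, r.2.1, r.2.2} : Finset ℕ) := by
    intro a ha
    rw [← hre]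
    simp only [Finset.mem_insert, Finset.mem_singleton] at ha ⊢
    rcases ha with rfl | rfl | rfl <;> simp
  have hA := hin a ha
  have hB := hin b hb
  generalize Bd D a = x at hA hd ⊢
  generalize Bd D b = y at hB hd ⊢
  obtain ⟨g1, g2, g3⟩ := hG r hr
  simp only [Finset.mem_insert, Finset.mem_singleton] at hA hB
  rw [SimpleGraph.mem_edgeSet]
  rcases hA with rfl | rfl | rfl <;> rcases hB with rfl | rfl | rfl <;>
    first
    | exact absurd (Sym2.mk_isDiag_iff.2 rfl) hd
    | assumption
    | (apply SimpleGraph.Adj.symm; assumption)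

lemma GoodM.congr {β : Type} [DecidableEq β] {E E' : ℕ → β} {L v : ℕ} {M : Finset ℕ} (h : GoodM E L v M)
    (hE : ∀ j < L, E j = E' j) : GoodM E' L v M := by
  have hs : ∀ j ∈ M, j < L := fun j hj => Finset.mem_range.1 (h.sub hj)
  refine ⟨h.sub, ?_, ?_, h.card⟩
  · intro j hj k hk hjk
    rw [← hE j (hs j hj), ← hE k (hs k hk)] at hjk
    exact h.inj hj hk hjk
  · intro j hj
    have := h.two j hj
    rw [← hE j (hs j hj)]
    refine this.trans (le_of_eq ?_)
    unfold fib
    congr 1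
    ext k
    simp only [Finset.mem_filter, Finset.mem_range]
    constructor
    · rintro ⟨h1, h2⟩; exact ⟨h1, by rw [← hE k h1, h2]⟩
    · rintro ⟨h1, h2⟩; exact ⟨h1, by rw [hE k h1, h2]⟩

lemma exists_code {n l v w : ℕ} {D : DiagState (Fin n)} (hD : D ∈ Pvw n l v w) (L : ℕ)
    (hL : L + 2 = 2 * v + w) :
    ∃ κ : Code n, KRel l κ D ∧ κ.1.length = l ∧ flv κ.1 = L ∧
      (κ.2.2.1.length + 1 = L ∧ (κ.2.1 :: κ.2.2.1).toFinset.card = v ∧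
        GoodM (cE κ.2.1 (κ.2.1 :: κ.2.2.1)) L v κ.2.2.2) ∧
      3 * v + w ≤ (EK κ).card + l + 3 := by
  obtain ⟨hS, h3, hlen, hcard, hgood, F, hF, hFe⟩ := Pvw_facts hD
  have hLL : D.boundary.length = L := by omega
  obtain ⟨Φ, p1, p2, p3⟩ := hS.fr
  obtain ⟨x, rest, hx⟩ : ∃ x rest, D.boundary.map D.label = x :: rest := by
    cases hb : D.boundary.map D.label with
    | nil => have := congrArg List.length hb; simp at this; simp [this] at h3
    | cons x rest => exact ⟨x, rest, rfl⟩
  have hrel : KRel l ((Φ, x, rest, Mk D) : Code n) D := ⟨hS, by omega, p3, hx, rfl⟩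
  have hxl : (x :: rest).length = L := by rw [← hx, List.length_map, hLL]
  refine ⟨(Φ, x, rest, Mk D), hrel, p1, by rw [p2, hLL], ⟨by simpa using hxl, by rw [← hx]; exact hcard, ?_⟩, ?_⟩
  · rw [hLL] at hgood
    refine hgood.congr ?_
    intro j hj
    unfold edgeLbl cE
    rw [hrel.label, hrel.label]
    simp only [PL, hxl]
    rw [Nat.mod_eq_of_lt hj]
  · have : F ⊆ EK ((Φ, x, rest, Mk D) : Code n) := by
      intro e he
      obtain ⟨hd, t, ht, a, ha, b, hb, rfl⟩ := hFe e he
      simp only [EK, Finset.mem_filter, Finset.mem_univ, true_and]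
      refine ⟨hd, ?_⟩
      rw [p3] at ht
      obtain ⟨q, hq, rfl⟩ := ht
      refine ⟨q, hq, ?_⟩
      have key : ∀ a ∈ ({Bd D q.1, Bd D q.2.1, Bd D q.2.2} : Finset ℕ),
          ∃ a' ∈ ({q.1, q.2.1, q.2.2} : Finset ℕ), a = Bd D a' := by
        intro a ha
        simp only [Finset.mem_insert, Finset.mem_singleton] at ha
        rcases ha with rfl | rfl | rfl
        · exact ⟨q.1, by simp, rfl⟩
        · exact ⟨q.2.1, by simp, rfl⟩
        · exact ⟨q.2.2, by simp, rfl⟩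
      obtain ⟨a', ha', rfl⟩ := key a ha
      obtain ⟨b', hb', rfl⟩ := key b hb
      exact ⟨a', ha', b', hb', by rw [hrel.label, hrel.label]⟩
    have := Finset.card_le_card this
    omega

open scoped Classical in
lemma Zval_le {n l v w : ℕ} (L : ℕ) (hL : L + 2 = 2 * v + w) (S : Finset (Code n))
    (hS : ∀ κ : Code n, κ.1.length = l → flv κ.1 = L →
      (κ.2.2.1.length + 1 = L ∧ (κ.2.1 :: κ.2.2.1).toFinset.card = v ∧
        GoodM (cE κ.2.1 (κ.2.1 :: κ.2.2.1)) L v κ.2.2.2) →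
      3 * v + w ≤ (EK κ).card + l + 3 → κ ∈ S) (G : SimpleGraph (Fin n)) :
    Zval n l v w G ≤ (S.filter (fun κ => ∀ e ∈ EK κ, e ∈ G.edgeSet)).card := by
  unfold Zval
  have ex : ∀ D : {D : DiagState (Fin n) // D ∈ Pvw n l v w ∧ FacesInGraph D G},
      ∃ κ ∈ S.filter (fun κ => ∀ e ∈ EK κ, e ∈ G.edgeSet), KRel l κ D.1 := by
    intro D
    obtain ⟨κ, k1, k2, k3, k4, k5⟩ := exists_code D.2.1 L hL
    exact ⟨κ, Finset.mem_filter.2 ⟨hS κ k2 k3 k4 k5, k1.EK_faces D.2.2⟩, k1⟩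
  choose code hc1 hc2 using ex
  set r := fun (D₁ D₂ : {D : DiagState (Fin n) // D ∈ Pvw n l v w ∧ FacesInGraph D G}) =>
    DiagIso D₁.1 D₂.1 with hr
  have hinj : Function.Injective (fun q : Quot r =>
      (⟨code q.out, hc1 q.out⟩ : {κ // κ ∈ S.filter (fun κ => ∀ e ∈ EK κ, e ∈ G.edgeSet)})) := by
    intro q₁ q₂ h
    have h : code q₁.out = code q₂.out := congrArg Subtype.val h
    have h1 := hc2 q₁.out
    rw [h] at h1
    have := Quot.sound (r := r) (h1.iso (hc2 q₂.out))
    rwa [Quot.out_eq, Quot.out_eq] at this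
  have := Nat.card_le_card_of_injective _ hinj
  rwa [Nat.card_eq_fintype_card (α := {κ // κ ∈ _}), Fintype.card_coe] at this

open scoped Classical in
lemma expZ_le (n l v w : ℕ) (p : ℝ) (hv : 1 ≤ v) (hp0 : 0 ≤ p) (hp1 : p ≤ 1) (L : ℕ)
    (hL : L + 2 = 2 * v + w) :
    expZ n l v w p ≤ 2 ^ (2 * L - l) * ((v : ℝ) ^ (6 * w) * ((n : ℝ) ^ v * (2 + 1 / v) ^ L) *
      (2 ^ (L + 1 - v) * (1 + 1 / v) ^ L)) * p ^ (3 * v + w - l - 3) := by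
  obtain ⟨SF, hSF, hSFc⟩ := forest_finset l L
  set SP : Finset (Fin n × List (Fin n) × Finset ℕ) :=
    (Finset.univ ×ˢ (listsOf (Fin n) (L - 1) ×ˢ (Finset.range L).powerset)).filter
      (fun q => q.2.1.length + 1 = L ∧ (q.1 :: q.2.1).toFinset.card = v ∧
        GoodM (cE q.1 (q.1 :: q.2.1)) L v q.2.2) with hSP
  have hpc := pair_count v w L hv hL SP (fun q hq => (Finset.mem_filter.1 hq).2)
  rw [Fintype.card_fin] at hpc
  set S : Finset (Code n) := (SF ×ˢ SP).filter (fun κ => 3 * v + w ≤ (EK κ).card + l + 3) with hSd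
  have hS : ∀ κ : Code n, κ.1.length = l → flv κ.1 = L →
      (κ.2.2.1.length + 1 = L ∧ (κ.2.1 :: κ.2.2.1).toFinset.card = v ∧
        GoodM (cE κ.2.1 (κ.2.1 :: κ.2.2.1)) L v κ.2.2.2) →
      3 * v + w ≤ (EK κ).card + l + 3 → κ ∈ S := by
    intro κ h1 h2 h3 h4
    refine Finset.mem_filter.2 ⟨Finset.mem_product.2 ⟨hSF _ h1 h2, Finset.mem_filter.2 ⟨?_, h3⟩⟩, h4⟩
    simp only [Finset.mem_product, Finset.mem_univ, true_and, Finset.mem_powerset]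
    exact ⟨(mem_listsOf _ _).2 (by omega), h3.2.2.sub⟩
  have hcardS : (S.card : ℝ) ≤ 2 ^ (2 * L - l) * SP.card := by
    have h1 : S.card ≤ SF.card * SP.card := by
      rw [← Finset.card_product]; exact Finset.card_filter_le _ _
    have h2 : S.card ≤ 2 ^ (2 * L - l) * SP.card := h1.trans (Nat.mul_le_mul_right _ hSFc)
    exact_mod_cast h2
  have hwt : ∀ G : SimpleGraph (Fin n), 0 ≤ p ^ edgeCard G * (1 - p) ^ (n.choose 2 - edgeCard G) :=
    fun G => mul_nonneg (pow_nonneg hp0 _) (pow_nonneg (by linarith) _)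
  calc expZ n l v w p
      ≤ ∑ G : SimpleGraph (Fin n), (p ^ edgeCard G * (1 - p) ^ (n.choose 2 - edgeCard G)) *
          ∑ κ ∈ S, (if ∀ e ∈ EK κ, e ∈ G.edgeSet then (1:ℝ) else 0) := by
        unfold expZ
        refine Finset.sum_le_sum fun G _ => mul_le_mul_of_nonneg_left ?_ (hwt G)
        have := Zval_le L hL S hS G
        rw [Finset.sum_boole]
        exact_mod_cast this
    _ = ∑ κ ∈ S, ∑ G : SimpleGraph (Fin n), (if ∀ e ∈ EK κ, e ∈ G.edgeSet then
          p ^ edgeCard G * (1 - p) ^ (n.choose 2 - edgeCard G) else 0) := by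
        rw [Finset.sum_comm]
        refine Finset.sum_congr rfl fun G _ => ?_
        rw [Finset.mul_sum]
        refine Finset.sum_congr rfl fun κ _ => ?_
        simp only [mul_ite, mul_one, mul_zero]
    _ ≤ ∑ κ ∈ S, p ^ (3 * v + w - l - 3) := by
        refine Finset.sum_le_sum fun κ hκ => ?_
        refine (prob_le n p hp0 hp1 (EK κ)).trans ?_
        have := (Finset.mem_filter.1 hκ).2
        exact pow_le_pow_of_le_one hp0 hp1 (by omega)
    _ = S.card * p ^ (3 * v + w - l - 3) := by rw [Finset.sum_const, nsmul_eq_mul]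
    _ ≤ _ := by
        refine mul_le_mul_of_nonneg_right ?_ (pow_nonneg hp0 _)
        exact hcardS.trans (mul_le_mul_of_nonneg_left hpc (by positivity))
end Codes

lemma asym_bound (c : ℝ) (hc0 : 0 < c) (hc1 : c ≤ 1) (n l v w L : ℕ) (p δ : ℝ) (hn : 1 ≤ n)
    (hp0 : 0 ≤ p) (hp : p ≤ c * (n : ℝ) ^ (-(1 : ℝ) / 3)) (hl : 3 ≤ l) (hv : l ≤ v)
    (hL : L + 2 = 2 * v + w)
    (h1 : 16 * Real.exp 1 ≤ (n : ℝ) ^ δ) (h2 : Real.exp 2 * (c⁻¹) ^ 2 ≤ (n : ℝ) ^ δ) :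
    2 ^ (2 * L - l) * ((v : ℝ) ^ (6 * w) * ((n : ℝ) ^ v * (2 + 1 / v) ^ L) *
      (2 ^ (L + 1 - v) * (1 + 1 / v) ^ L)) * p ^ (3 * v + w - l - 3) ≤
    (n : ℝ) ^ ((-(1 : ℝ) / 3 + δ) * (w : ℝ) + ((1 : ℝ) / 3 + δ) * (l : ℝ) + 1)
          * (v : ℝ) ^ (6 * w) * ((2 : ℝ) ^ (7 : ℕ) * c ^ (3 : ℕ)) ^ v := by
  have hn0 : (0 : ℝ) < n := by exact_mod_cast hn
  have hv0 : (3 : ℝ) ≤ v := by exact_mod_cast hl.trans hv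
  have hvp : (0 : ℝ) < v := by linarith
  obtain ⟨m, hm⟩ : ∃ m, m = 3 * v + w - l - 3 := ⟨_, rfl⟩
  have hm' : m + l + 3 = 3 * v + w := by omega
  rw [← hm]
  have hmR : (m : ℝ) = 3 * v + w - l - 3 := by
    have : ((m + l + 3 : ℕ) : ℝ) = ((3 * v + w : ℕ) : ℝ) := by rw [hm']
    push_cast at this; linarith
  have hLR : (L : ℝ) ≤ 2 * v + w := by
    have : ((L + 2 : ℕ) : ℝ) = ((2 * v + w : ℕ) : ℝ) := by rw [hL]
    push_cast at this; linarith
  -- the factor `(1 + 1/v)^L`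
  have hq : (0 : ℝ) ≤ 1 / v := by positivity
  have e1 : ((1 : ℝ) + 1 / v) ^ L * (1 + 1 / v) ^ L ≤ Real.exp 1 ^ w * Real.exp 2 ^ l := by
    rw [← mul_pow]
    have : ((1 : ℝ) + 1 / v) * (1 + 1 / v) ≤ Real.exp (2 / v) := by
      have h := Real.add_one_le_exp (1 / (v : ℝ))
      have e : Real.exp (2 / v) = Real.exp (1 / v) * Real.exp (1 / v) := by
        rw [← Real.exp_add]; congr 1; ring
      rw [e]
      apply mul_le_mul <;> first | linarith | positivity
    refine (pow_le_pow_left₀ (by positivity) this L).trans ?_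
    rw [← Real.exp_nat_mul, ← Real.exp_nat_mul, ← Real.exp_nat_mul, ← Real.exp_add]
    apply Real.exp_le_exp.2
    have hl' : (3 : ℝ) ≤ l := by exact_mod_cast hl
    have : (L : ℝ) * (2 / v) ≤ (2 * v + w) * (2 / v) :=
      mul_le_mul_of_nonneg_right hLR (by positivity)
    have e : ((2 : ℝ) * v + w) * (2 / v) = 4 + w * (2 / v) := by field_simp; ring
    have h3 : (2 : ℝ) / v ≤ 1 := by rw [div_le_one hvp]; linarith
    have h4 : (w : ℝ) * (2 / v) ≤ w * 1 := mul_le_mul_of_nonneg_left h3 (by positivity)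
    linarith
  have e2 : ((2 : ℝ) + 1 / v) ^ L ≤ 2 ^ L * (1 + 1 / v) ^ L := by
    rw [← mul_pow]; apply pow_le_pow_left₀ (by positivity); linarith
  have e3 : (2 : ℝ) ^ (2 * L - l) * 2 ^ L * 2 ^ (L + 1 - v) ≤ (2 ^ 7) ^ v * 16 ^ w := by
    have : (16 : ℝ) = 2 ^ 4 := by norm_num
    rw [this, ← pow_mul, ← pow_mul, ← pow_add, ← pow_add, ← pow_add]
    apply pow_le_pow_right₀ (by norm_num); omega
  have e4 : c ^ m ≤ (c ^ 3) ^ v * ((c⁻¹) ^ 2) ^ l := by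
    have : c ^ m * c ^ (2 * l) ≤ c ^ (3 * v) := by
      rw [← pow_add]; apply pow_le_pow_of_le_one hc0.le hc1; omega
    rw [← pow_mul, ← pow_mul, inv_pow]
    rw [← div_eq_mul_inv, le_div_iff₀ (by positivity)]; exact this
  have e5 : p ^ m ≤ c ^ m * ((n : ℝ) ^ (-(1 : ℝ) / 3)) ^ m := by
    rw [← mul_pow]; exact pow_le_pow_left₀ hp0 hp m
  have e6 : (n : ℝ) ^ ((-(1 : ℝ) / 3 + δ) * (w : ℝ) + ((1 : ℝ) / 3 + δ) * (l : ℝ) + 1) =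
      ((n : ℝ) ^ v * ((n : ℝ) ^ (-(1 : ℝ) / 3)) ^ m) * (((n : ℝ) ^ δ) ^ w * ((n : ℝ) ^ δ) ^ l) := by
    rw [← Real.rpow_natCast (n : ℝ) v, ← Real.rpow_mul_natCast hn0.le, ← Real.rpow_mul_natCast hn0.le,
      ← Real.rpow_mul_natCast hn0.le, ← Real.rpow_add hn0, ← Real.rpow_add hn0, ← Real.rpow_add hn0,
      hmR]
    congr 1; ring
  have e7 : (16 * Real.exp 1) ^ w * (Real.exp 2 * (c⁻¹) ^ 2) ^ l ≤
      ((n : ℝ) ^ δ) ^ w * ((n : ℝ) ^ δ) ^ l :=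
    mul_le_mul (pow_le_pow_left₀ (by positivity) h1 _) (pow_le_pow_left₀ (by positivity) h2 _)
      (by positivity) (by positivity)
  rw [e6]
  set N : ℝ := (n : ℝ) ^ v
  set M : ℝ := ((n : ℝ) ^ (-(1 : ℝ) / 3)) ^ m
  have hN : 0 ≤ N := by positivity
  have hM : 0 ≤ M := by positivity
  set W : ℝ := (v : ℝ) ^ (6 * w)
  have hW : 0 ≤ W := by positivity
  set Q : ℝ := (1 + 1 / (v : ℝ)) ^ L
  have hQ : 0 ≤ Q := by positivity
  calc _ ≤ 2 ^ (2 * L - l) * (W * (N * (2 ^ L * Q)) * (2 ^ (L + 1 - v) * Q)) * (c ^ m * M) := by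
        gcongr
    _ = (2 ^ (2 * L - l) * 2 ^ L * 2 ^ (L + 1 - v)) * (Q * Q) * c ^ m * (W * N * M) := by ring
    _ ≤ ((2 ^ 7) ^ v * 16 ^ w) * (Real.exp 1 ^ w * Real.exp 2 ^ l) *
          ((c ^ 3) ^ v * ((c⁻¹) ^ 2) ^ l) * (W * N * M) := by gcongr
    _ = ((16 * Real.exp 1) ^ w * (Real.exp 2 * (c⁻¹) ^ 2) ^ l) *
          (W * N * M * (2 ^ 7 * c ^ 3) ^ v) := by
        simp only [mul_pow]; ring
    _ ≤ (((n : ℝ) ^ δ) ^ w * ((n : ℝ) ^ δ) ^ l) * (W * N * M * (2 ^ 7 * c ^ 3) ^ v) := by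
        gcongr
    _ = _ := by ring

/-- For `p < c n^{-1/3}` with `c ∈ (0, 2^{-7/3})` constant, and
sequences `3 ≤ ℓ(n) ≤ v(n)`, `w(n) ≤ 2 v(n)²`, for every `δ > 0` and all large enough
`n`, `E[Z^ℓ_{v,w}] ≤ n^{(−1/3+δ) w + (1/3+δ) ℓ + 1} · v^{6w} · (2⁷ c³)^v`. -/
theorem statement12 (c : ℝ) (hc0 : 0 < c) (hc : c < (2 : ℝ) ^ (-(7 : ℝ) / 3))
    (p : ℕ → ℝ) (hp0 : ∀ n, 0 ≤ p n)
    (hp : ∀ n : ℕ, 1 ≤ n → p n < c * (n : ℝ) ^ (-(1 : ℝ) / 3))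
    (ℓ v w : ℕ → ℕ) (hℓ : ∀ n, 3 ≤ ℓ n) (hv : ∀ n, ℓ n ≤ v n)
    (hw : ∀ n, w n ≤ 2 * (v n) ^ 2) :
    ∀ δ : ℝ, 0 < δ → ∃ n₀ : ℕ, ∀ n ≥ n₀,
      expZ n (ℓ n) (v n) (w n) (p n) ≤
        (n : ℝ) ^ ((-(1 : ℝ) / 3 + δ) * (w n : ℝ) + ((1 : ℝ) / 3 + δ) * (ℓ n : ℝ) + 1)
          * (v n : ℝ) ^ (6 * w n) * ((2 : ℝ) ^ (7 : ℕ) * c ^ (3 : ℕ)) ^ (v n) := by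
  intro δ hδ
  have hc1 : c ≤ 1 :=
    hc.le.trans (Real.rpow_le_one_of_one_le_of_nonpos (by norm_num) (by norm_num))
  have ht := (tendsto_rpow_atTop hδ).comp (tendsto_natCast_atTop_atTop (R := ℝ))
  have hev := (ht.eventually_ge_atTop (16 * Real.exp 1)).and
    ((ht.eventually_ge_atTop (Real.exp 2 * (c⁻¹) ^ 2)).and (Filter.eventually_ge_atTop 1))
  obtain ⟨n₀, hn₀⟩ := Filter.eventually_atTop.1 hev
  refine ⟨n₀, fun n hn => ?_⟩
  obtain ⟨h1, h2, h3⟩ := hn₀ n hn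
  simp only [Function.comp] at h1 h2
  have hpn := hp n h3
  have hp1 : p n ≤ 1 := by
    have hle : (n : ℝ) ^ (-(1 : ℝ) / 3) ≤ 1 :=
      Real.rpow_le_one_of_one_le_of_nonpos (by exact_mod_cast h3) (by norm_num)
    have h0 : 0 ≤ (n : ℝ) ^ (-(1 : ℝ) / 3) := by positivity
    nlinarith
  have hl := hℓ n
  have hvn := hv n
  obtain ⟨L, hL⟩ : ∃ L, L + 2 = 2 * v n + w n := ⟨2 * v n + w n - 2, by omega⟩
  exact (expZ_le n (ℓ n) (v n) (w n) (p n) (by omega) (hp0 n) hp1 L hL).trans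
    (asym_bound c hc0 hc1 n (ℓ n) (v n) (w n) L (p n) δ h3 (hp0 n) hpn.le hl hvn hL h1 h2)

end WSat
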